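/- arXiv:0801.1319 — 2 statements merged into one kernel-verified Lean document; each statement's English description precedes it below -/
import Mathlib

section
/- Let w ∈ W_{n,q} and let λ = Heckeshape(w) be the common shape of the tableaux produced by Hecke insertion of w. Then λ_1 = LIS(w) and λ'_1 = LDS(w); i.e., the length of the first row of λ equals the length of the longest strictly increasing subsequence of w, and the length of the first column of λ equals the length of the longest strictly decreasing subsequence of w. -/
/-- Replace row `i` of `T` by `r`, appending a new row if `i = T.length`. -/
def setRow (T : List (List ℕ)) (i : ℕ) (r : List ℕ) : List (List ℕ) :=
  if i < T.length then T.set i r else T ++ [r]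

/-- One pass of Hecke insertion (BKSTY): insert value `x` starting at row `i`,
with `fuel` bounding the number of rows visited. -/
def heckeAux : ℕ → ℕ → List (List ℕ) → ℕ → List (List ℕ)
  | 0, _, T, _ => T
  | fuel + 1, x, T, i =>
    let R := T.getD i []
    if R.all (· ≤ x) then
      -- terminating step: adjoin `x` at the end of row `i` if this yields an
      -- increasing tableau, otherwise leave the tableau unchanged
      if (x ∉ R) ∧ (i = 0 ∨ (R.length < (T.getD (i - 1) []).length ∧
            (T.getD (i - 1) []).getD R.length 0 < x)) then
        setRow T i (R ++ [x])
      else T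
    else
      -- bumping step: `y` is the smallest entry of the row larger than `x`;
      -- replace it by `x` if this yields an increasing tableau; in any case
      -- insert `y` into the next row
      let p := (R.takeWhile (· ≤ x)).length
      let y := R.getD p 0
      let T' := if (p = 0 ∨ R.getD (p - 1) 0 < x) ∧
            (i = 0 ∨ (T.getD (i - 1) []).getD p 0 < x) then setRow T i (R.set p x) else T
      heckeAux fuel y T' (i + 1)

/-- Hecke insertion of a value `x` into an increasing tableau `T`. -/
def heckeInsert (T : List (List ℕ)) (x : ℕ) : List (List ℕ) :=
  heckeAux (T.length + 1) x T 0

/-- The insertion tableau `P` of a word under the Hecke algorithm. -/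
def heckeP (w : List ℕ) : List (List ℕ) := w.foldl heckeInsert []

/-- The shape `Heckeshape w` of the Hecke insertion tableau of `w`. -/
def heckeShape (w : List ℕ) : List ℕ := (heckeP w).map List.length

/-- Length of the longest strictly increasing subsequence of a word. -/
noncomputable def LIS (w : List ℕ) : ℕ :=
  sSup {k | ∃ s : List ℕ, s.Sublist w ∧ s.Chain' (· < ·) ∧ s.length = k}

/-- Length of the longest strictly decreasing subsequence of a word. -/
noncomputable def LDS (w : List ℕ) : ℕ :=
  sSup {k | ∃ s : List ℕ, s.Sublist w ∧ s.Chain' (· > ·) ∧ s.length = k}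


namespace HeckeProof

/-- Strictly decreasing subsequences of `w` can be transferred to `w'`. -/
def Dom (w w' : List ℕ) : Prop :=
  ∀ s : List ℕ, s.Sublist w → s.Pairwise (· > ·) →
    ∃ s' : List ℕ, s'.Sublist w' ∧ s'.Pairwise (· > ·) ∧ s.length ≤ s'.length ∧
      ∀ z ∈ s', (∃ u ∈ s, u ≤ z) ∧ (∃ v ∈ s, z ≤ v)

theorem Dom.refl (w : List ℕ) : Dom w w := fun s h1 h2 =>
  ⟨s, h1, h2, le_rfl, fun z hz => ⟨⟨z, hz, le_rfl⟩, ⟨z, hz, le_rfl⟩⟩⟩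

theorem Dom.of_sublist {w w' : List ℕ} (h : w.Sublist w') : Dom w w' := fun s h1 h2 =>
  ⟨s, h1.trans h, h2, le_rfl, fun z hz => ⟨⟨z, hz, le_rfl⟩, ⟨z, hz, le_rfl⟩⟩⟩

theorem Dom.trans {a b c : List ℕ} (h : Dom a b) (h' : Dom b c) : Dom a c := by
  intro s h1 h2
  obtain ⟨t, t1, t2, t3, t4⟩ := h s h1 h2
  obtain ⟨r, r1, r2, r3, r4⟩ := h' t t1 t2
  refine ⟨r, r1, r2, t3.trans r3, fun z hz => ?_⟩
  obtain ⟨⟨u, hu, hu'⟩, ⟨v, hv, hv'⟩⟩ := r4 z hz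
  obtain ⟨⟨u2, hu2, hu2'⟩, -⟩ := t4 u hu
  obtain ⟨-, ⟨v2, hv2, hv2'⟩⟩ := t4 v hv
  exact ⟨⟨u2, hu2, hu2'.trans hu'⟩, ⟨v2, hv2, hv'.trans hv2'⟩⟩

theorem Dom.congr {a b : List ℕ} (u v : List ℕ) (h : Dom a b) :
    Dom (u ++ (a ++ v)) (u ++ (b ++ v)) := by
  intro s h1 h2
  obtain ⟨s1, s23, rfl, hs1, hs23⟩ := List.sublist_append_iff.1 h1
  obtain ⟨s2, s3, rfl, hs2, hs3⟩ := List.sublist_append_iff.1 hs23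
  rw [List.pairwise_append, List.pairwise_append] at h2
  obtain ⟨p1, ⟨p2, p3, p23⟩, p123⟩ := h2
  obtain ⟨t, t1, t2, t3, t4⟩ := h s2 hs2 p2
  refine ⟨s1 ++ (t ++ s3), hs1.append (t1.append hs3), ?_, by simp; omega, ?_⟩
  · rw [List.pairwise_append, List.pairwise_append]
    refine ⟨p1, ⟨t2, p3, ?_⟩, ?_⟩
    · intro z hz c hc
      obtain ⟨⟨u, hu, hu'⟩, -⟩ := t4 z hz
      have := p23 u hu c hc
      omega
    · intro c hc z hz
      rcases List.mem_append.1 hz with hz | hz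
      · obtain ⟨-, ⟨v, hv, hv'⟩⟩ := t4 z hz
        have := p123 c hc v (by simp [hv])
        omega
      · exact p123 c hc z (by simp [hz])
  · intro z hz
    rcases List.mem_append.1 hz with hz | hz
    · exact ⟨⟨z, by simp [hz], le_rfl⟩, ⟨z, by simp [hz], le_rfl⟩⟩
    rcases List.mem_append.1 hz with hz | hz
    · obtain ⟨⟨u, hu, hu'⟩, ⟨v, hv, hv'⟩⟩ := t4 z hz
      exact ⟨⟨u, by simp [hu], hu'⟩, ⟨v, by simp [hv], hv'⟩⟩
    · exact ⟨⟨z, by simp [hz], le_rfl⟩, ⟨z, by simp [hz], le_rfl⟩⟩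

theorem dec_row {R s : List ℕ} (hR : R.Pairwise (· < ·)) (hs : s.Sublist R)
    (hd : s.Pairwise (· > ·)) : s = [] ∨ ∃ r ∈ R, s = [r] := by
  have h1 := hR.sublist hs
  match s, hs, hd, h1 with
  | [], _, _, _ => exact Or.inl rfl
  | [r], hs, _, _ => exact Or.inr ⟨r, by simpa using hs, rfl⟩
  | a :: b :: t, _, hd, h1 =>
    simp only [List.pairwise_cons] at hd h1
    have := hd.1 b (by simp)
    have := h1.1 b (by simp)
    omega

theorem dec_row_x {R s : List ℕ} {x : ℕ} (hR : R.Pairwise (· < ·))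
    (hs : s.Sublist (R ++ [x])) (hd : s.Pairwise (· > ·)) :
    s = [] ∨ s = [x] ∨ (∃ r ∈ R, s = [r]) ∨ ∃ r ∈ R, x < r ∧ s = [r, x] := by
  obtain ⟨s1, s2, rfl, h1, h2⟩ := List.sublist_append_iff.1 hs
  rw [List.pairwise_append] at hd
  have h3 : s2 = [] ∨ s2 = [x] := by
    rcases s2 with _ | ⟨a, _ | ⟨b, t⟩⟩
    · simp
    · simpa using h2
    · have := h2.length_le; simp at this
  rcases dec_row hR h1 hd.1 with rfl | ⟨r, hr, rfl⟩ <;> rcases h3 with rfl | rfl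
  · simp
  · simp
  · right; right; left; exact ⟨r, hr, rfl⟩
  · right; right; right
    exact ⟨r, hr, by simpa using hd.2.2, rfl⟩

/-- Bumping, backwards direction. -/
theorem dom_bump_back {R R' : List ℕ} {x y : ℕ} (hR' : R'.Pairwise (· < ·))
    (hy : y ∈ R) (h1 : ∀ r ∈ R', r ∈ R ∨ r = x) (h2 : ∀ r ∈ R', r < y → r ≤ x) (hxy : x < y) :
    Dom (y :: R') (R ++ [x]) := by
  intro s hs hd
  have key : s = [] ∨ s = [y] ∨ (∃ r ∈ R', s = [r]) ∨ ∃ r ∈ R', r < y ∧ s = [y, r] := by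
    rcases List.sublist_cons_iff.1 hs with h | ⟨t, rfl, ht⟩
    · rcases dec_row hR' h hd with rfl | ⟨r, hr, rfl⟩
      · simp
      · right; right; left; exact ⟨r, hr, rfl⟩
    · rw [List.pairwise_cons] at hd
      rcases dec_row hR' ht hd.2 with rfl | ⟨r, hr, rfl⟩
      · simp
      · right; right; right; exact ⟨r, hr, by simpa using hd.1, rfl⟩
  rcases key with rfl | rfl | ⟨r, hr, rfl⟩ | ⟨r, hr, hry, rfl⟩
  · exact ⟨[], by simp⟩
  · exact ⟨[y], by simp [hy]⟩
  · exact ⟨[r], by simpa using h1 r hr⟩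
  · have := h2 r hr hry
    refine ⟨[y, x], (List.singleton_sublist.2 hy).append (List.Sublist.refl [x]), by simpa using hxy, by simp, ?_⟩
    simp
    omega

/-- Bumping, forward direction, unblocked case. -/
theorem dom_bump {R R' : List ℕ} {x y : ℕ} (hR : R.Pairwise (· < ·))
    (hx : x ∈ R') (h1 : ∀ r ∈ R, r ∈ R' ∨ r = y) (h2 : ∀ r ∈ R, x < r → y ≤ r) (hxy : x < y) :
    Dom (R ++ [x]) (y :: R') := by
  intro s hs hd
  rcases dec_row_x hR hs hd with rfl | rfl | ⟨r, hr, rfl⟩ | ⟨r, hr, hrx, rfl⟩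
  · exact ⟨[], by simp⟩
  · exact ⟨[x], by simp [hx]⟩
  · refine ⟨[r], ?_⟩
    have := h1 r hr
    simp; tauto
  · have := h2 r hr hrx
    refine ⟨[y, x], by simp [hx], by simpa using hxy, by simp, ?_⟩
    simp
    omega

/-- Bumping, forward direction, blocked case. -/
theorem dom_bump_blocked {R Q : List ℕ} {x y : ℕ} (hR : R.Pairwise (· < ·))
    (hQ : Q.Pairwise (· < ·)) (hx : x ∈ Q) (h2 : ∀ r ∈ R, x < r → y ≤ r) (hxy : x < y)
    (h3 : ∀ q ∈ Q, q < x → ∃ r ∈ R, q < r ∧ r ≤ x) :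
    Dom (R ++ [x] ++ Q) (y :: R ++ Q) := by
  intro s hs hd
  obtain ⟨s1, s2, rfl, hs1, hs2⟩ := List.sublist_append_iff.1 hs
  have hd' := hd
  rw [List.pairwise_append] at hd
  rcases dec_row_x hR hs1 hd.1 with rfl | rfl | ⟨r, hr, rfl⟩ | ⟨r, hr, hrx, rfl⟩
  · refine ⟨s2, ?_, hd.2.1, by simp, fun z hz => ⟨⟨z, hz, le_rfl⟩, ⟨z, hz, le_rfl⟩⟩⟩
    exact hs2.trans (List.sublist_append_right _ _)
  · rcases dec_row hQ hs2 hd.2.1 with rfl | ⟨q, hq, rfl⟩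
    · exact ⟨[x], by simp [hx]⟩
    · obtain ⟨r, hr, hqr, hrx⟩ := h3 q hq (by simpa using hd.2.2)
      refine ⟨[r] ++ [q], List.Sublist.append ?_ (by simpa using hq), by simpa using hqr, by simp, ?_⟩
      · simp [hr]
      · simp; try omega
  · refine ⟨[r] ++ s2, List.Sublist.append (by simp [hr]) hs2, hd', by simp,
      fun z hz => ⟨⟨z, hz, le_rfl⟩, ⟨z, hz, le_rfl⟩⟩⟩
  · rcases dec_row hQ hs2 hd.2.1 with rfl | ⟨q, hq, rfl⟩
    · refine ⟨[r] ++ [x], List.Sublist.append (by simp [hr]) (by simpa using hx), by simpa using hrx, by simp, ?_⟩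
      simp; try omega
    · have hqx : q < x := by have := hd.2.2 x (by simp) q (by simp); omega
      obtain ⟨r1, hr1, hqr, hrx1⟩ := h3 q hq hqx
      have := h2 r hr hrx
      refine ⟨[y, r1] ++ [q], List.Sublist.append (by simp [hr1]) (by simpa using hq), ?_, by simp, ?_⟩
      · simp; try omega
      · simp; try omega

/-- Terminating, blocked case. -/
theorem dom_term_blocked {R Q : List ℕ} {x : ℕ} (hR : R.Pairwise (· < ·))
    (hQ : Q.Pairwise (· < ·)) (hx : x ∈ Q) (h2 : ∀ r ∈ R, r ≤ x)
    (h3 : ∀ q ∈ Q, q < x → ∃ r ∈ R, q < r ∧ r ≤ x) :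
    Dom (R ++ [x] ++ Q) (R ++ Q) := by
  intro s hs hd
  obtain ⟨s1, s2, rfl, hs1, hs2⟩ := List.sublist_append_iff.1 hs
  have hd' := hd
  rw [List.pairwise_append] at hd
  rcases dec_row_x hR hs1 hd.1 with rfl | rfl | ⟨r, hr, rfl⟩ | ⟨r, hr, hrx, rfl⟩
  · refine ⟨s2, ?_, hd.2.1, by simp, fun z hz => ⟨⟨z, hz, le_rfl⟩, ⟨z, hz, le_rfl⟩⟩⟩
    exact hs2.trans (List.sublist_append_right _ _)
  · rcases dec_row hQ hs2 hd.2.1 with rfl | ⟨q, hq, rfl⟩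
    · exact ⟨[x], by simp [hx]⟩
    · obtain ⟨r, hr, hqr, hrx⟩ := h3 q hq (by simpa using hd.2.2)
      refine ⟨[r] ++ [q], List.Sublist.append ?_ (by simpa using hq), by simpa using hqr, by simp, ?_⟩
      · simp [hr]
      · simp; try omega
  · refine ⟨[r] ++ s2, List.Sublist.append (by simp [hr]) hs2, hd', by simp,
      fun z hz => ⟨⟨z, hz, le_rfl⟩, ⟨z, hz, le_rfl⟩⟩⟩
  · have := h2 r hr
    omega

/-- Terminating, `x` already in the row. -/
theorem dom_term_mem {R : List ℕ} {x : ℕ} (hR : R.Pairwise (· < ·))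
    (hx : x ∈ R) (h2 : ∀ r ∈ R, r ≤ x) : Dom (R ++ [x]) R := by
  intro s hs hd
  rcases dec_row_x hR hs hd with rfl | rfl | ⟨r, hr, rfl⟩ | ⟨r, hr, hrx, rfl⟩
  · exact ⟨[], by simp⟩
  · exact ⟨[x], by simp [hx]⟩
  · exact ⟨[r], by simp [hr]⟩
  · have := h2 r hr
    omega

/-- Row reading word: rows from bottom to top. -/
def read : List (List ℕ) → List ℕ
  | [] => []
  | R :: T => read T ++ R

theorem read_append (a b : List (List ℕ)) : read (a ++ b) = read b ++ read a := by
  induction a with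
  | nil => simp [read]
  | cons R a ih => simp [read, ih]

/-- Row `Q` may stand directly above row `R`. -/
def Above (Q R : List ℕ) : Prop :=
  R.length ≤ Q.length ∧ ∀ j < R.length, Q.getD j 0 < R.getD j 0

/-- Increasing tableaux. -/
def Tab (T : List (List ℕ)) : Prop :=
  T.IsChain Above ∧ ∀ R ∈ T, R.Pairwise (· < ·) ∧ R ≠ []

theorem getD_lt {R : List ℕ} (hR : R.Pairwise (· < ·)) {i j : ℕ} (hij : i < j) (hj : j < R.length) :
    R.getD i 0 < R.getD j 0 := by
  have := List.pairwise_iff_getElem.1 hR i j (by omega) hj hij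
  simpa [List.getD_eq_getElem?_getD, hj, show i < R.length by omega] using this

theorem getD_mem {R : List ℕ} {i : ℕ} (hi : i < R.length) : R.getD i 0 ∈ R := by
  simp [List.getD_eq_getElem?_getD, hi]

theorem mem_getD {R : List ℕ} {z : ℕ} (hz : z ∈ R) : ∃ i < R.length, R.getD i 0 = z := by
  obtain ⟨i, hi, h⟩ := List.mem_iff_getElem.1 hz
  exact ⟨i, hi, by simp [List.getD_eq_getElem?_getD, hi, h]⟩

theorem chain_replace {r : List ℕ → List ℕ → Prop} {pre rest : List (List ℕ)} {R R' : List ℕ}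
    (h : (pre ++ R :: rest).IsChain r) (h1 : ∀ Q ∈ pre.getLast?, r Q R')
    (h2 : ∀ N ∈ rest.head?, r R' N) : (pre ++ R' :: rest).IsChain r := by
  rw [List.isChain_append, List.isChain_cons] at h ⊢
  refine ⟨h.1, ⟨h2, h.2.1.2⟩, ?_⟩
  intro Q hQ N hN
  simp at hN
  subst hN
  exact h1 Q hQ

theorem above_cond (pre rest : List (List ℕ)) (f : List ℕ → Prop) :
    (pre.length = 0 ∨ f ((pre ++ rest).getD (pre.length - 1) [])) ↔ ∀ Q ∈ pre.getLast?, f Q := by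
  rcases List.eq_nil_or_concat pre with rfl | ⟨p, Q, rfl⟩
  · simp
  · simp [List.getD_eq_getElem?_getD]

theorem setRow_eq (pre rest : List (List ℕ)) (R R' : List ℕ) :
    setRow (pre ++ R :: rest) pre.length R' = pre ++ R' :: rest := by
  simp [setRow]

theorem setRow_eq' (pre : List (List ℕ)) (R' : List ℕ) :
    setRow pre pre.length R' = pre ++ [R'] := by
  simp [setRow]

/-- Invariant of the inserted value at a row. -/
def Inv (pre rest : List (List ℕ)) (x : ℕ) : Prop :=
  ∀ Q ∈ pre.getLast?, ∃ p < Q.length, Q.getD p 0 ≤ x ∧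
    ∀ R ∈ rest.head?, p < R.length → x < R.getD p 0

/-- Decomposition of a row at the bumped entry. -/
theorem bump_decomp {R : List ℕ} {x : ℕ} (h : ¬ ∀ r ∈ R, r ≤ x) :
    ∃ A y B, R = A ++ y :: B ∧ R.takeWhile (· ≤ x) = A ∧ (∀ a ∈ A, a ≤ x) ∧ x < y := by
  induction R with
  | nil => simp at h
  | cons c R ih =>
    by_cases hc : c ≤ x
    · obtain ⟨A, y, B, h1, h2, h3, h4⟩ := ih (by intro h'; apply h; simpa [hc] using h')
      refine ⟨c :: A, y, B, by simp [h1], ?_, by simpa [hc] using h3, h4⟩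
      rw [List.takeWhile_cons]; simp [hc, h2]
    · exact ⟨[], c, R, rfl, by simp [hc], by simp, by omega⟩



theorem blocked_facts {Q R : List ℕ} {x p : ℕ} (hQ : Q.Pairwise (· < ·)) (hab : Above Q R)
    (hp : p ≤ R.length) (hA : ∀ j < p, R.getD j 0 ≤ x)
    (hinv : ∃ p' < Q.length, Q.getD p' 0 ≤ x ∧ (p' < R.length → x < R.getD p' 0))
    (hb : ¬ (p < Q.length ∧ Q.getD p 0 < x)) :
    x ∈ Q ∧ ∀ q ∈ Q, q < x → ∃ r ∈ R, q < r ∧ r ≤ x := by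
  obtain ⟨p', hp', h1, h2⟩ := hinv
  have hpp : p ≤ p' := by
    by_contra hlt
    have := hA p' (by omega)
    have := h2 (by omega)
    omega
  have hpQ : p < Q.length := by omega
  have hle : Q.getD p 0 ≤ Q.getD p' 0 := by
    rcases Nat.lt_or_ge p p' with h | h
    · exact (getD_lt hQ h hp').le
    · rw [show p = p' by omega]
  have hx : Q.getD p 0 = x := by
    have : ¬ Q.getD p 0 < x := fun h => hb ⟨hpQ, h⟩
    omega
  refine ⟨hx ▸ getD_mem hpQ, ?_⟩
  intro q hq hqx
  obtain ⟨j, hj, rfl⟩ := mem_getD hq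
  have hjp : j < p := by
    by_contra hlt
    rcases Nat.lt_or_ge p j with h | h
    · have := getD_lt hQ h hj
      omega
    · have : j = p := by omega
      subst this
      omega
  exact ⟨R.getD j 0, getD_mem (by omega), hab.2 j (by omega), hA j hjp⟩

/-- Two-sided version of `Dom`. -/
def Eqv (a b : List ℕ) : Prop := Dom a b ∧ Dom b a

theorem Eqv.trans {a b c : List ℕ} (h : Eqv a b) (h' : Eqv b c) : Eqv a c :=
  ⟨h.1.trans h'.1, h'.2.trans h.2⟩

theorem Eqv.congr {a b : List ℕ} (u v : List ℕ) (h : Eqv a b) :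
    Eqv (u ++ (a ++ v)) (u ++ (b ++ v)) := ⟨h.1.congr u v, h.2.congr u v⟩

theorem Eqv.refl (a : List ℕ) : Eqv a a := ⟨.refl a, .refl a⟩

/-- One row, terminating. -/
theorem term_step {pre tl : List (List ℕ)} {R : List ℕ} {x : ℕ}
    (hR : R.Pairwise (· < ·)) (hpre : ∀ Q ∈ pre, Q.Pairwise (· < ·))
    (hab : ∀ Q ∈ pre.getLast?, Above Q R)
    (hinv : ∀ Q ∈ pre.getLast?, ∃ p < Q.length, Q.getD p 0 ≤ x ∧ (p < R.length → x < R.getD p 0))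
    (hall : ∀ r ∈ R, r ≤ x)
    (hc : ¬ (x ∉ R ∧ ∀ Q ∈ pre.getLast?, R.length < Q.length ∧ Q.getD R.length 0 < x)) :
    Eqv (read tl ++ (R ++ [x] ++ read pre)) (read tl ++ (R ++ read pre)) := by
  by_cases hx : x ∈ R
  · exact Eqv.congr _ _ ⟨dom_term_mem hR hx hall, Dom.of_sublist (List.sublist_append_left _ _)⟩
  · have hc' : ∃ Q ∈ pre.getLast?, ¬ (R.length < Q.length ∧ Q.getD R.length 0 < x) := by
      by_contra hcon
      apply hc
      refine ⟨hx, fun Q hQ => ?_⟩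
      by_contra h
      exact hcon ⟨Q, hQ, h⟩
    obtain ⟨Q, hQ, hb⟩ := hc'
    have hab' := hab Q hQ
    have hinv' := hinv Q hQ
    obtain ⟨pre0, rfl⟩ := List.getLast?_eq_some_iff.1 hQ
    have hQs := hpre Q (by simp)
    obtain ⟨h1, h2⟩ := blocked_facts hQs hab' le_rfl (fun j hj => hall _ (getD_mem hj)) hinv' hb
    have := Eqv.congr (read tl) (read pre0) (a := R ++ [x] ++ Q) (b := R ++ Q)
      ⟨dom_term_blocked hR hQs h1 hall h2,
        Dom.of_sublist ((List.sublist_append_left _ _).append (List.Sublist.refl _))⟩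
    simpa [read_append, read] using this

theorem getD_mid (A B : List ℕ) (y : ℕ) : (A ++ y :: B).getD A.length 0 = y := by
  simp [List.getD_eq_getElem?_getD]

theorem getD_left {A : List ℕ} (B : List ℕ) {j : ℕ} (hj : j < A.length) :
    (A ++ B).getD j 0 = A.getD j 0 := by
  simp [List.getD_eq_getElem?_getD, List.getElem?_append_left hj]

theorem getD_other (A B : List ℕ) (x y : ℕ) {j : ℕ} (hj : j ≠ A.length) :
    (A ++ x :: B).getD j 0 = (A ++ y :: B).getD j 0 := by
  rcases Nat.lt_or_ge j A.length with h | h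
  · rw [getD_left _ h, getD_left _ h]
  · obtain ⟨k, rfl⟩ : ∃ k, j = A.length + (k + 1) := ⟨j - A.length - 1, by omega⟩
    simp [List.getD_eq_getElem?_getD, List.getElem?_append_right]

theorem last_cond {A : List ℕ} (B : List ℕ) {x y : ℕ} (sA : A.Pairwise (· < ·))
    (hAx : ∀ a ∈ A, a ≤ x) :
    (A.length = 0 ∨ (A ++ y :: B).getD (A.length - 1) 0 < x) ↔ x ∉ A := by
  rcases List.eq_nil_or_concat A with rfl | ⟨A0, a, hA⟩
  · simp
  · rw [List.concat_eq_append] at hA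
    subst hA
    rw [List.pairwise_append] at sA
    have h0 : ((A0 ++ [a]) ++ y :: B).getD ((A0 ++ [a]).length - 1) 0 = a := by
      simp [List.getD_eq_getElem?_getD]
    rw [h0]
    have := hAx a (by simp)
    constructor
    · rintro (h | h) hx
      · simp at h
      · rcases List.mem_append.1 hx with h' | h'
        · have := sA.2.2 x h' a (by simp); omega
        · simp at h'; omega
    · intro h
      right
      have : x ≠ a := fun h' => h (by simp [h'])
      omega

/-- Main property of Hecke insertion. -/
theorem heckeAux_main : ∀ (rest pre : List (List ℕ)) (x fuel : ℕ), fuel = rest.length + 1 →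
    Tab (pre ++ rest) → Inv pre rest x →
    Tab (heckeAux fuel x (pre ++ rest) pre.length) ∧
    Eqv (read rest ++ ([x] ++ read pre)) (read (heckeAux fuel x (pre ++ rest) pre.length)) := by
  intro rest
  induction rest with
  | nil =>
    intro pre x fuel hf hT hI
    subst hf
    simp only [List.append_nil] at hT ⊢
    have hg : pre.getD pre.length [] = [] := by simp
    have hac := above_cond pre [] (fun Q => 0 < Q.length ∧ Q.getD 0 0 < x)
    simp only [List.append_nil] at hac
    have key := @term_step pre [] [] x (by simp) (fun Q hQ => (hT.2 Q hQ).1)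
      (fun Q hQ => ⟨by simp, by simp⟩)
      (fun Q hQ => by obtain ⟨p, h1, h2, h3⟩ := hI Q hQ; exact ⟨p, h1, h2, by simp⟩) (by simp)
    rw [heckeAux]
    simp only [hg, List.all_nil, if_true, List.length_nil, List.nil_append, setRow_eq', hac] at key ⊢
    split_ifs with hc
    · refine ⟨⟨?_, ?_⟩, ?_⟩
      · rw [List.isChain_append]
        refine ⟨hT.1, by simp, ?_⟩
        intro Q hQ N hN
        simp at hN
        subst hN
        have := hc.2 Q hQ
        refine ⟨by simp; omega, ?_⟩
        intro j hj
        simp at hj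
        subst hj
        simpa using this.2
      · intro R hR
        rcases List.mem_append.1 hR with h | h
        · exact hT.2 R h
        · simp at h; subst h; simp
      · simp [read_append, read]; exact Eqv.refl _
    · exact ⟨hT, by simpa [read] using key hc⟩
  | cons R rest ih =>
    intro pre x fuel hf hT hI
    subst hf
    have hg : (pre ++ R :: rest).getD pre.length [] = R := by simp [List.getD_eq_getElem?_getD]
    obtain ⟨hch, hrows⟩ := hT
    obtain ⟨hRs, hRn⟩ := hrows R (by simp)
    have hpre : ∀ Q ∈ pre, Q.Pairwise (· < ·) := fun Q hQ => (hrows Q (by simp [hQ])).1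
    have hch' := hch
    rw [List.isChain_append, List.isChain_cons] at hch'
    obtain ⟨-, ⟨hbelow, -⟩, habove⟩ := hch'
    have hab : ∀ Q ∈ pre.getLast?, Above Q R := fun Q hQ => habove Q hQ R (by simp)
    have hinv : ∀ Q ∈ pre.getLast?, ∃ p < Q.length, Q.getD p 0 ≤ x ∧
        (p < R.length → x < R.getD p 0) := fun Q hQ => by
      obtain ⟨p, h1, h2, h3⟩ := hI Q hQ
      exact ⟨p, h1, h2, h3 R (by simp)⟩
    rw [heckeAux]
    simp only [hg]
    by_cases hall : ∀ r ∈ R, r ≤ x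
    · have hall' : (R.all fun r => decide (r ≤ x)) = true := by simpa using hall
      have hac := above_cond pre (R :: rest) (fun Q => R.length < Q.length ∧ Q.getD R.length 0 < x)
      have key := @term_step pre rest R x hRs hpre hab hinv hall
      simp only [hall', if_true, hac, setRow_eq]
      split_ifs with hc
      · have hlt : ∀ r ∈ R, r < x := fun r hr => by
          have := hall r hr
          have : r ≠ x := fun h => hc.1 (h ▸ hr)
          omega
        refine ⟨⟨chain_replace hch ?_ ?_, ?_⟩, ?_⟩
        · intro Q hQ
          have h1 := hc.2 Q hQ
          have h2 := hab Q hQ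
          refine ⟨by simp; omega, ?_⟩
          intro j hj
          simp at hj
          rcases Nat.lt_or_ge j R.length with h | h
          · rw [getD_left _ h]; exact h2.2 j h
          · have : j = R.length := by omega
            subst this
            rw [getD_mid]; exact h1.2
        · intro N hN
          have h2 := hbelow N hN
          refine ⟨by simp; have := h2.1; omega, ?_⟩
          intro j hj
          rw [getD_left _ (lt_of_lt_of_le hj h2.1)]
          exact h2.2 j hj
        · intro S hS
          simp only [List.mem_append, List.mem_cons] at hS
          rcases hS with h | rfl | h
          · exact hrows S (by simp [h])
          · refine ⟨?_, by simp⟩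
            rw [List.pairwise_append]
            exact ⟨hRs, by simp, by simpa using hlt⟩
          · exact hrows S (by simp [h])
        · simp [read_append, read]; exact Eqv.refl _
      · exact ⟨⟨hch, hrows⟩, by simpa [read_append, read] using key hc⟩
    · have hall' : ¬ (R.all fun r => decide (r ≤ x)) = true := by simpa using hall
      simp only [hall']
      obtain ⟨A, y, B, rfl, hA, hAx, hxy⟩ := bump_decomp hall
      simp only [hA, getD_mid, List.set_append_right _ _ (le_refl _), Nat.sub_self, List.set_cons_zero,
        setRow_eq, above_cond pre ((A ++ y :: B) :: rest) (fun Q => Q.getD A.length 0 < x)]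
      have hRs' := hRs
      rw [List.pairwise_append, List.pairwise_cons] at hRs'
      obtain ⟨sA, ⟨hyB, sB⟩, hAyB⟩ := hRs'
      have hcA : (A.length = 0 ∨ (A ++ y :: B).getD (A.length - 1) 0 < x) ↔ x ∉ A := last_cond B sA hAx
      simp only [hcA]
      have hminR : ∀ r ∈ A ++ y :: B, x < r → y ≤ r := by
        intro r hr hxr
        simp only [List.mem_append, List.mem_cons] at hr
        rcases hr with h | rfl | h
        · have := hAx r h; omega
        · exact le_rfl
        · exact (hyB r h).le
      have hsmall : ∀ r ∈ A ++ y :: B, r < y → r ≤ x := by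
        intro r hr hxr
        by_contra h
        have := hminR r hr (by omega)
        omega
      -- reduce to a statement about the new row
      suffices H : ∀ R', (R' = if x ∉ A ∧ ∀ Q ∈ pre.getLast?, Q.getD A.length 0 < x then A ++ x :: B
          else A ++ y :: B) → (Tab (pre ++ R' :: rest)) ∧
            Inv (pre ++ [R']) rest y ∧
            Eqv (read rest ++ (A ++ y :: B ++ [x] ++ read pre)) (read rest ++ (y :: R' ++ read pre)) by
        obtain ⟨h1, h2, h3⟩ := H _ rfl
        have := ih (pre ++ [if x ∉ A ∧ ∀ Q ∈ pre.getLast?, Q.getD A.length 0 < x then A ++ x :: B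
          else A ++ y :: B]) y (rest.length + 1) rfl (by simpa using h1) h2
        simp only [List.append_assoc, List.singleton_append, List.length_append, List.length_singleton,
          Bool.false_eq_true, if_false, List.length_cons, apply_ite (fun S => pre ++ S :: rest)] at this ⊢
        refine ⟨this.1, Eqv.trans ?_ this.2⟩
        simpa [read_append, read] using h3
      intro R' hR'
      split_ifs at hR' with hc
      · subst hR'
        have hAlt : ∀ a ∈ A, a < x := fun a ha => by
          have := hAx a ha
          have : a ≠ x := fun h => hc.1 (h ▸ ha)
          omega
        have sR' : (A ++ x :: B).Pairwise (· < ·) := by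
          rw [List.pairwise_append, List.pairwise_cons]
          refine ⟨sA, ⟨fun b hb => hxy.trans (hyB b hb), sB⟩, ?_⟩
          intro a ha b hb
          rcases List.mem_cons.1 hb with rfl | hb
          · exact hAlt a ha
          · exact hAyB a ha b (by simp [hb])
        refine ⟨⟨chain_replace hch ?_ ?_, ?_⟩, ?_, ?_⟩
        · intro Q hQ
          have h1 := hab Q hQ
          refine ⟨by simpa using h1.1, ?_⟩
          intro j hj
          by_cases hj' : j = A.length
          · subst hj'
            rw [getD_mid]; exact hc.2 Q hQ
          · rw [getD_other A B x y hj']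
            exact h1.2 j (by simpa using hj)
        · intro N hN
          have h1 := hbelow N hN
          refine ⟨by simpa using h1.1, ?_⟩
          intro j hj
          have h2 := h1.2 j hj
          by_cases hj' : j = A.length
          · subst hj'
            rw [getD_mid] at h2 ⊢; omega
          · rwa [getD_other A B x y hj']
        · intro S hS
          simp only [List.mem_append, List.mem_cons] at hS
          rcases hS with h | rfl | h
          · exact hrows S (by simp [h])
          · exact ⟨sR', by simp⟩
          · exact hrows S (by simp [h])
        · intro Q hQ
          simp at hQ
          subst hQ
          refine ⟨A.length, by simp, by rw [getD_mid]; exact hxy.le, ?_⟩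
          intro N hN hlt
          have := (hbelow N hN).2 _ hlt
          rwa [getD_mid] at this
        · refine Eqv.congr _ _ ⟨dom_bump hRs (by simp) ?_ hminR hxy, dom_bump_back sR' (by simp) ?_ ?_ hxy⟩
          · intro r hr
            simp at hr ⊢; tauto
          · intro r hr
            simp at hr ⊢; tauto
          · intro r hr hry
            simp only [List.mem_append, List.mem_cons] at hr
            rcases hr with h | rfl | h
            · exact hAx r h
            · exact le_rfl
            · have := hyB r h; omega
      · subst hR'
        refine ⟨⟨hch, hrows⟩, ?_, ?_⟩
        · intro Q hQ
          simp at hQ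
          subst hQ
          refine ⟨A.length, by simp, by rw [getD_mid], ?_⟩
          intro N hN hlt
          have := (hbelow N hN).2 _ hlt
          rwa [getD_mid] at this
        · have hback : Dom (y :: (A ++ y :: B)) (A ++ y :: B ++ [x]) :=
            dom_bump_back hRs (by simp) (fun r hr => Or.inl hr) hsmall hxy
          by_cases hx : x ∈ A
          · exact Eqv.congr _ _ ⟨dom_bump hRs (by simp [hx]) (fun r hr => Or.inl hr) hminR hxy, hback⟩
          · have hc' : ∃ Q ∈ pre.getLast?, ¬ (Q.getD A.length 0 < x) := by
              by_contra hcon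
              apply hc
              refine ⟨hx, fun Q hQ => ?_⟩
              by_contra h
              exact hcon ⟨Q, hQ, h⟩
            obtain ⟨Q, hQ, hb⟩ := hc'
            have hab' := hab Q hQ
            have hinv' := hinv Q hQ
            obtain ⟨pre0, rfl⟩ := List.getLast?_eq_some_iff.1 hQ
            have hQs := hpre Q (by simp)
            obtain ⟨h1, h2⟩ := blocked_facts (p := A.length) hQs hab' (by simp)
              (fun j hj => by rw [getD_left _ hj]; exact hAx _ (getD_mem hj)) hinv' (fun h => hb h.2)
            have hback' := hback.congr [] Q
            have := Eqv.congr (read rest) (read pre0)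
              ⟨dom_bump_blocked hRs hQs h1 hminR hxy h2, by simpa using hback'⟩
            simpa [read_append, read] using this

theorem heckeInsert_main {T : List (List ℕ)} (hT : Tab T) (x : ℕ) :
    Tab (heckeInsert T x) ∧ Eqv (read T ++ [x]) (read (heckeInsert T x)) := by
  have := heckeAux_main T [] x (T.length + 1) rfl hT (by intro Q hQ; simp at hQ)
  simpa [read, heckeInsert] using this

theorem heckeP_main (w : List ℕ) : Tab (heckeP w) ∧ Eqv w (read (heckeP w)) := by
  induction w using List.reverseRecOn with
  | nil => exact ⟨⟨by simp [heckeP], by simp [heckeP]⟩, Eqv.refl _⟩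
  | append_singleton w x ih =>
    have h1 := heckeInsert_main ih.1 x
    have h2 : heckeP (w ++ [x]) = heckeInsert (heckeP w) x := by simp [heckeP]
    rw [h2]
    refine ⟨h1.1, Eqv.trans ?_ h1.2⟩
    simpa using Eqv.congr [] [x] ih.2

theorem dec_read_le {T : List (List ℕ)} (hT : ∀ R ∈ T, R.Pairwise (· < ·)) :
    ∀ s : List ℕ, s.Sublist (read T) → s.Pairwise (· > ·) → s.length ≤ T.length := by
  induction T with
  | nil => intro s hs _; simpa [read] using hs
  | cons R T ih =>
    intro s hs hd
    obtain ⟨s1, s2, rfl, h1, h2⟩ := List.sublist_append_iff.1 hs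
    rw [List.pairwise_append] at hd
    have h3 := ih (fun R hR => hT R (by simp [hR])) s1 h1 hd.1
    rcases dec_row (hT R (by simp)) h2 hd.2.1 with rfl | ⟨r, _, rfl⟩ <;> simp <;> omega

theorem dec_read_col {T : List (List ℕ)} (hT : Tab T) :
    ∃ s : List ℕ, s.Sublist (read T) ∧ s.Pairwise (· > ·) ∧ s.length = T.length := by
  refine ⟨(T.map (fun R => R.getD 0 0)).reverse, ?_, ?_, by simp⟩
  · have h := hT.2
    clear hT
    induction T with
    | nil => simp [read]
    | cons R T ih =>
      simp only [List.map_cons, List.reverse_cons, read]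
      refine (ih fun S hS => h S (by simp [hS])).append ?_
      exact List.singleton_sublist.2 (getD_mem (List.length_pos_iff.2 (h R (by simp)).2))
  · rw [List.pairwise_reverse]
    apply List.IsChain.pairwise
    rw [List.isChain_map]
    obtain ⟨h1, h2⟩ := hT
    induction T with
    | nil => simp
    | cons R T ih =>
      rw [List.isChain_cons] at h1 ⊢
      refine ⟨?_, ih h1.2 fun S hS => h2 S (by simp [hS])⟩
      intro N hN
      exact (h1.1 N hN).2 0 (List.length_pos_iff.2 (h2 N (by simp [List.mem_of_mem_head? hN])).2)

theorem sSup_eq {S : Set ℕ} {m : ℕ} (h1 : m ∈ S) (h2 : ∀ k ∈ S, k ≤ m) : sSup S = m :=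
  IsGreatest.csSup_eq ⟨h1, h2⟩

theorem rows_eq_LDS (w : List ℕ) : (heckeP w).length = LDS w := by
  obtain ⟨hT, h1, h2⟩ := heckeP_main w
  symm
  have hle : ∀ s : List ℕ, s.Sublist w → s.Pairwise (· > ·) → s.length ≤ (heckeP w).length := by
    intro s hs hd
    obtain ⟨t, t1, t2, t3, -⟩ := h1 s hs hd
    exact t3.trans (dec_read_le (fun R hR => (hT.2 R hR).1) t t1 t2)
  apply sSup_eq
  · obtain ⟨s, s1, s2, s3⟩ := dec_read_col hT
    obtain ⟨t, t1, t2, t3, -⟩ := h2 s s1 s2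
    exact ⟨t, t1, t2.isChain, le_antisymm (hle t t1 t2) (by omega)⟩
  · rintro k ⟨s, s1, s2, rfl⟩
    exact hle s s1 (List.IsChain.pairwise s2)

/-! First row. -/

theorem setRow_head {T : List (List ℕ)} {i : ℕ} (r : List ℕ) (hi : 1 ≤ i) (hT : T ≠ []) :
    setRow T i r ≠ [] ∧ (setRow T i r).getD 0 [] = T.getD 0 [] := by
  obtain ⟨R, T, rfl⟩ := List.exists_cons_of_ne_nil hT
  obtain ⟨i, rfl⟩ : ∃ k, i = k + 1 := ⟨i - 1, by omega⟩
  unfold setRow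
  split_ifs <;> simp

theorem heckeAux_head (fuel : ℕ) : ∀ (y : ℕ) (T : List (List ℕ)) (i : ℕ), 1 ≤ i → T ≠ [] →
    (heckeAux fuel y T i).getD 0 [] = T.getD 0 [] := by
  induction fuel with
  | zero => intros; simp [heckeAux]
  | succ f ih =>
    intro y T i hi hT
    rw [heckeAux]
    simp only []
    split_ifs
    · exact (setRow_head _ hi hT).2
    · rfl
    · rw [ih _ _ _ (by omega) (setRow_head _ hi hT).1]
      exact (setRow_head _ hi hT).2
    · rw [ih _ _ _ (by omega) hT]

/-- Abstract first row step. -/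
def RowStep (R : List ℕ) (x : ℕ) (R' : List ℕ) : Prop :=
  ∃ c < R'.length, R'.getD c 0 = x ∧ R.length ≤ R'.length ∧
    (∀ j < R.length, R'.getD j 0 ≤ R.getD j 0) ∧
    (∀ j < R.length, c ≤ j → x ≤ R.getD j 0) ∧
    (∀ j < R'.length, j ≠ c → j < R.length ∧ R'.getD j 0 = R.getD j 0) ∧
    (∀ j < c, R.getD j 0 < x)

theorem rowStep_mem {R : List ℕ} {x : ℕ} (hR : R.Pairwise (· < ·)) (hx : x ∈ R) : RowStep R x R := by
  obtain ⟨c, hc, rfl⟩ := mem_getD hx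
  refine ⟨c, hc, rfl, le_rfl, fun _ _ => le_rfl, ?_, fun j hj _ => ⟨hj, rfl⟩, fun j hj => getD_lt hR hj hc⟩
  intro j hj hcj
  rcases Nat.lt_or_ge c j with h | h
  · exact (getD_lt hR h hj).le
  · rw [show j = c by omega]

theorem rowStep_append {R : List ℕ} {x : ℕ} (hx : ∀ r ∈ R, r < x) : RowStep R x (R ++ [x]) := by
  refine ⟨R.length, by simp, getD_mid R [] x, by simp, ?_, ?_, ?_, ?_⟩
  · intro j hj; rw [getD_left _ hj]
  · intro j hj h; omega
  · intro j hj h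
    have : j < R.length := by simp at hj; omega
    exact ⟨this, getD_left _ this⟩
  · intro j hj; exact hx _ (getD_mem hj)

theorem rowStep_bump {A B : List ℕ} {x y : ℕ} (hA : ∀ r ∈ A, r < x) (hxy : x < y)
    (hR : (A ++ y :: B).Pairwise (· < ·)) : RowStep (A ++ y :: B) x (A ++ x :: B) := by
  refine ⟨A.length, by simp, getD_mid A B x, by simp, ?_, ?_, ?_, ?_⟩
  · intro j hj
    by_cases h : j = A.length
    · subst h; rw [getD_mid, getD_mid]; exact hxy.le
    · rw [getD_other A B x y h]
  · intro j hj h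
    rcases Nat.lt_or_ge A.length j with h' | h'
    · have := getD_lt hR h' hj
      rw [getD_mid] at this
      omega
    · rw [show j = A.length by omega, getD_mid]; exact hxy.le
  · intro j hj h
    exact ⟨by simpa using hj, getD_other A B x y h⟩
  · intro j hj
    rw [getD_left _ hj]; exact hA _ (getD_mem hj)

theorem heckeInsert_head {T : List (List ℕ)} {x : ℕ} (hR : (T.getD 0 []).Pairwise (· < ·)) :
    RowStep (T.getD 0 []) x ((heckeInsert T x).getD 0 []) := by
  have hset : ∀ r, (setRow T 0 r).getD 0 [] = r := by
    intro r; unfold setRow; rcases T with _ | ⟨R, T⟩ <;> simp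
  have hset' : ∀ r, setRow T 0 r ≠ [] := by
    intro r; unfold setRow; rcases T with _ | ⟨R, T⟩ <;> simp
  unfold heckeInsert
  rw [heckeAux]
  generalize hRdef : T.getD 0 [] = R at *
  simp only [true_or, and_true]
  by_cases hall : ∀ r ∈ R, r ≤ x
  · have hall' : (R.all fun r => decide (r ≤ x)) = true := by simpa using hall
    simp only [hall', if_true]
    split_ifs with hx
    rotate_left
    · rw [hset]
      apply rowStep_append
      intro r hr
      have := hall r hr
      have : r ≠ x := fun h => hx (h ▸ hr)
      omega
    · rw [hRdef]
      exact rowStep_mem hR hx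
  · have hall' : ¬ (R.all fun r => decide (r ≤ x)) = true := by simpa using hall
    obtain ⟨A, y, B, rfl, hA, hAx, hxy⟩ := bump_decomp hall
    have sA : A.Pairwise (· < ·) := (List.pairwise_append.1 hR).1
    have hT : T ≠ [] := by rintro rfl; simp at hRdef
    simp only [hall', hA, last_cond B sA hAx]
    rw [if_neg (by simp)]
    split_ifs with hx
    rotate_left
    · rw [heckeAux_head _ _ _ _ (by omega) (hset' _), hset]
      rw [List.set_append_right _ _ (le_refl _), Nat.sub_self, List.set_cons_zero]
      apply rowStep_bump _ hxy hR
      intro r hr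
      have := hAx r hr
      have : r ≠ x := fun h => hx (h ▸ hr)
      omega
    · rw [heckeAux_head _ _ _ _ (by omega) hT, hRdef]
      exact rowStep_mem hR (by simp [hx])

/-- Patience sorting invariant. -/
def Pat (w R : List ℕ) : Prop :=
  (∀ t l, (t ++ [l]).Sublist w → (t ++ [l]).Pairwise (· < ·) →
    t.length < R.length ∧ R.getD t.length 0 ≤ l) ∧
  (∀ k < R.length, ∃ t, (t ++ [R.getD k 0]).Sublist w ∧ (t ++ [R.getD k 0]).Pairwise (· < ·) ∧
    t.length = k)

theorem Pat.step {w R R' : List ℕ} {x : ℕ} (h : Pat w R) (hs : RowStep R x R') :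
    Pat (w ++ [x]) R' := by
  obtain ⟨c, hc, hcx, hlen, hle, hge, hoth, hlt⟩ := hs
  obtain ⟨h1, h2⟩ := h
  have hcR : c ≤ R.length := by
    rcases Nat.eq_zero_or_pos c with h | h
    · omega
    · have := (hoth (c - 1) (by omega) (by omega)).1
      omega
  constructor
  · intro t l hs hp
    obtain ⟨s1, s2, he, hs1, hs2⟩ := List.sublist_append_iff.1 hs
    have h3 : s2 = [] ∨ s2 = [x] := by
      rcases s2 with _ | ⟨a, _ | ⟨b, u⟩⟩
      · simp
      · simpa using hs2
      · have := hs2.length_le; simp at this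
    rcases h3 with rfl | rfl
    · rw [List.append_nil] at he
      rw [← he] at hs1
      obtain ⟨h4, h5⟩ := h1 t l hs1 hp
      exact ⟨by omega, (hle _ h4).trans h5⟩
    · obtain ⟨rfl, he2⟩ := List.append_inj' he rfl
      have hlx : l = x := by simpa using he2
      subst hlx
      have htc : t.length ≤ c := by
        rcases List.eq_nil_or_concat t with rfl | ⟨t', m, ht⟩
        · simp
        · rw [List.concat_eq_append] at ht
          subst ht
          rw [List.pairwise_append] at hp
          obtain ⟨h4, h5⟩ := h1 t' m hs1 hp.1
          have hml := hp.2.2 m (by simp) l (by simp)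
          by_contra hcon
          simp at hcon
          have := hge _ h4 (by omega)
          omega
      refine ⟨by omega, ?_⟩
      rcases Nat.lt_or_ge t.length c with h6 | h6
      · rw [(hoth _ (by omega) (by omega)).2]
        exact (hlt _ h6).le
      · rw [show t.length = c by omega, hcx]
  · intro k hk
    by_cases hkc : k = c
    · subst hkc
      rw [hcx]
      rcases Nat.eq_zero_or_pos k with rfl | hpos
      · exact ⟨[], by simp⟩
      · obtain ⟨t, t1, t2, t3⟩ := h2 (k - 1) (by omega)
        refine ⟨t ++ [R.getD (k - 1) 0], t1.append (List.Sublist.refl _), ?_, by simp; omega⟩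
        have hx := hlt (k - 1) (by omega)
        rw [List.pairwise_append]
        refine ⟨t2, by simp, ?_⟩
        rw [List.pairwise_append] at t2
        intro a ha b hb
        rw [List.mem_singleton] at hb
        subst hb
        rcases List.mem_append.1 ha with h | h
        · exact (t2.2.2 a h _ (by simp)).trans hx
        · rw [List.mem_singleton] at h; subst h; exact hx
    · obtain ⟨h3, h4⟩ := hoth k hk hkc
      rw [h4]
      obtain ⟨t, t1, t2, t3⟩ := h2 k h3
      exact ⟨t, t1.trans (List.sublist_append_left _ _), t2, t3⟩

theorem pat_heckeP (w : List ℕ) : Pat w ((heckeP w).getD 0 []) := by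
  induction w using List.reverseRecOn with
  | nil => exact ⟨by simp, by simp [heckeP]⟩
  | append_singleton w x ih =>
    have h2 : heckeP (w ++ [x]) = heckeInsert (heckeP w) x := by simp [heckeP]
    rw [h2]
    refine ih.step (heckeInsert_head ?_)
    have hT := (heckeP_main w).1
    rcases hP : heckeP w with _ | ⟨R, T⟩
    · simp
    · simpa using (hT.2 R (by simp [hP])).1

theorem row_eq_LIS (w : List ℕ) : ((heckeP w).getD 0 []).length = LIS w := by
  obtain ⟨h1, h2⟩ := pat_heckeP w
  symm
  apply sSup_eq
  · rcases Nat.eq_zero_or_pos ((heckeP w).getD 0 []).length with h | h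
    · exact ⟨[], List.nil_sublist _, List.Pairwise.nil.isChain, h.symm⟩
    · obtain ⟨t, t1, t2, t3⟩ := h2 (((heckeP w).getD 0 []).length - 1) (by omega)
      refine ⟨_, t1, t2.isChain, ?_⟩
      rw [List.length_append, List.length_singleton]
      omega
  · rintro k ⟨s, s1, s2, rfl⟩
    rcases List.eq_nil_or_concat s with rfl | ⟨t, l, ht⟩
    · simp
    · rw [List.concat_eq_append] at ht
      subst ht
      have := (h1 t l s1 (List.IsChain.pairwise s2)).1
      rw [List.length_append, List.length_singleton]
      omega

end HeckeProof

/-- The first row of `Heckeshape w` has length `LIS w` and its first column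
(= number of rows, i.e. the first part of the conjugate shape) has length `LDS w`. -/
theorem heckeShape_row_col (n q : ℕ) (w : List ℕ) (hlen : w.length = n)
    (hent : ∀ x ∈ w, 1 ≤ x ∧ x ≤ q) :
    (heckeShape w).getD 0 0 = LIS w ∧ (heckeShape w).length = LDS w := by
  refine ⟨?_, ?_⟩
  · rw [← HeckeProof.row_eq_LIS, heckeShape]
    rcases heckeP w with _ | ⟨R, T⟩ <;> simp
  · rw [← HeckeProof.rows_eq_LDS, heckeShape, List.length_map]
end

section
/- Let w ∈ W_{n,q}. The Hecke shape of w equals the full staircase (q, q−1, ..., 2, 1) if and only if W(w) = w_0, the longest element of S_{q+1}. -/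
/-- The simple reflection `s_i = (i, i+1)` in `S_{q+1}`, for a letter `1 ≤ i ≤ q`. -/
def sRef (q i : ℕ) : Equiv.Perm (Fin (q + 1)) :=
  if h : 1 ≤ i ∧ i ≤ q then Equiv.swap ⟨i - 1, by omega⟩ ⟨i, by omega⟩ else 1

/-- The Coxeter length of a permutation of `{1, …, q+1}`: its number of inversions. -/
def lenPerm (q : ℕ) (π : Equiv.Perm (Fin (q + 1))) : ℕ :=
  (Finset.univ.filter
    (fun p : Fin (q + 1) × Fin (q + 1) => p.1 < p.2 ∧ π p.2 < π p.1)).card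

/-- One step of the 0-Hecke (Demazure) product: multiply by `s_i` only if the
Coxeter length increases. -/
def demStep (q : ℕ) (π : Equiv.Perm (Fin (q + 1))) (i : ℕ) : Equiv.Perm (Fin (q + 1)) :=
  if lenPerm q π < lenPerm q (π * sRef q i) then π * sRef q i else π

/-- The permutation `W(w) ∈ S_{q+1}` determined by a word `w` over `{1,…,q}`
via the 0-Hecke monoid (Demazure product of the letters of `w`). -/
def heckeW (q : ℕ) (w : List ℕ) : Equiv.Perm (Fin (q + 1)) := w.foldl (demStep q) 1


/-! ### The 0-Hecke monoid -/

lemma lenPerm_swap_aux (q : ℕ) (π : Equiv.Perm (Fin (q + 1))) (a b : Fin (q + 1))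
    (hab : a.val + 1 = b.val) (h : π a < π b) :
    lenPerm q (π * Equiv.swap a b) = lenPerm q π + 1 := by
  have hlt : a < b := by rw [Fin.lt_def]; omega
  unfold lenPerm
  set s := Equiv.swap a b with hs
  have hsa : s a = b := Equiv.swap_apply_left a b
  have hsb : s b = a := Equiv.swap_apply_right a b
  have key : (Finset.univ.filter (fun p : Fin (q + 1) × Fin (q + 1) =>
        p.1 < p.2 ∧ (π * s) p.2 < (π * s) p.1)) =
      insert (a, b) ((Finset.univ.filter (fun p : Fin (q + 1) × Fin (q + 1) =>
        p.1 < p.2 ∧ π p.2 < π p.1)).image (fun p => (s p.1, s p.2))) := by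
    ext ⟨x, y⟩
    rw [Finset.mem_filter, Finset.mem_insert, Finset.mem_image]
    simp only [Finset.mem_filter, Finset.mem_univ, true_and, Prod.mk.injEq,
      Equiv.Perm.mul_apply, Prod.exists]
    have hmono : ∀ x y : Fin (q + 1), x < y → ¬ (x = a ∧ y = b) → s x < s y := by
      intro x y hxy hne
      rw [hs, Equiv.swap_apply_def, Equiv.swap_apply_def]
      simp only [Fin.ext_iff, Fin.lt_def] at *
      split_ifs <;> omega
    have hss : ∀ x, s (s x) = x := fun x => by
      rw [hs, ← Equiv.Perm.mul_apply, Equiv.swap_mul_self]; rfl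
    constructor
    · rintro ⟨h1, h2⟩
      by_cases hc : x = a ∧ y = b
      · exact Or.inl hc
      · right
        exact ⟨s x, s y, ⟨hmono x y h1 hc, h2⟩, hss x, hss y⟩
    · rintro (⟨rfl, rfl⟩ | ⟨u, v, ⟨h1, h2⟩, rfl, rfl⟩)
      · rw [hsa, hsb]; exact ⟨hlt, h⟩
      · rw [hss, hss]
        refine ⟨hmono u v h1 ?_, h2⟩
        rintro ⟨rfl, rfl⟩
        exact absurd h2 (not_lt.mpr h.le)
  rw [key, Finset.card_insert_of_notMem, Finset.card_image_of_injective]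
  · rintro ⟨x, y⟩ ⟨u, v⟩ h
    simpa using h
  · simp only [Finset.mem_image, Finset.mem_filter, Finset.mem_univ, true_and, Prod.mk.injEq,
      Prod.exists, not_exists, not_and]
    rintro u v ⟨h1, h2⟩ h3 h4
    have hu : u = b := by apply s.injective; rw [h3, hsb]
    have hv : v = a := by apply s.injective; rw [h4, hsa]
    subst hu hv
    exact absurd h1 (not_lt.mpr hlt.le)

lemma lenPerm_lt_iff (q : ℕ) (π : Equiv.Perm (Fin (q + 1))) (a b : Fin (q + 1))
    (hab : a.val + 1 = b.val) :
    lenPerm q π < lenPerm q (π * Equiv.swap a b) ↔ π a < π b := by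
  constructor
  · intro h
    by_contra hc
    have hne : π a ≠ π b := by
      intro h; have := π.injective h; rw [this] at hab; omega
    have := lenPerm_swap_aux q (π * Equiv.swap a b) a b hab (by
      simpa using lt_of_le_of_ne (not_lt.mp hc) hne.symm)
    rw [mul_assoc, Equiv.swap_mul_self, mul_one] at this
    omega
  · intro h
    rw [lenPerm_swap_aux q π a b hab h]; omega

lemma demStep_out (q : ℕ) (π : Equiv.Perm (Fin (q + 1))) (i : ℕ) (h : ¬ (1 ≤ i ∧ i ≤ q)) :
    demStep q π i = π := by
  simp [demStep, sRef, h]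

lemma demStep_in (q : ℕ) (π : Equiv.Perm (Fin (q + 1))) (i : ℕ) (a b : Fin (q + 1))
    (ha : a.val + 1 = i) (hb : b.val = i) :
    demStep q π i = if π a < π b then π * Equiv.swap a b else π := by
  have h : 1 ≤ i ∧ i ≤ q := by omega
  have hs : sRef q i = Equiv.swap a b := by
    rw [sRef, dif_pos h]
    congr 1 <;> ext <;> simp <;> omega
  unfold demStep
  rw [hs]
  simp only [lenPerm_lt_iff q π a b (by omega)]

lemma demStep_len (q : ℕ) (π : Equiv.Perm (Fin (q + 1))) (i : ℕ) :
    lenPerm q (demStep q π i) ≤ lenPerm q π + 1 := by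
  by_cases h : 1 ≤ i ∧ i ≤ q
  · have e := demStep_in q π i ⟨i - 1, by omega⟩ ⟨i, by omega⟩ (by simp; omega) rfl
    rw [e]
    split_ifs with h1
    · rw [lenPerm_swap_aux q π _ _ (by simp; omega) h1]
    · omega
  · rw [demStep_out q π i h]; omega

lemma demStep_idem (q : ℕ) (π : Equiv.Perm (Fin (q + 1))) (i : ℕ) :
    demStep q (demStep q π i) i = demStep q π i := by
  by_cases h : 1 ≤ i ∧ i ≤ q
  · have e := fun π => demStep_in q π i ⟨i - 1, by omega⟩ ⟨i, by omega⟩ (by simp; omega) rfl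
    simp only [e]
    split_ifs with h1 h2
    · simp at h2; exact absurd h1 (not_lt.mpr h2.le)
    · rfl
    · rfl
  · simp only [demStep_out q _ i h]

lemma demStep_comm (q : ℕ) (π : Equiv.Perm (Fin (q + 1))) (i j : ℕ) (hij : i + 2 ≤ j) :
    demStep q (demStep q π i) j = demStep q (demStep q π j) i := by
  by_cases h : 1 ≤ i ∧ i ≤ q
  · by_cases h' : 1 ≤ j ∧ j ≤ q
    · obtain ⟨a, ha⟩ : ∃ a : Fin (q + 1), a.val + 1 = i := ⟨⟨i - 1, by omega⟩, by simp; omega⟩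
      obtain ⟨b, hb⟩ : ∃ a : Fin (q + 1), a.val = i := ⟨⟨i, by omega⟩, rfl⟩
      obtain ⟨c, hc⟩ : ∃ a : Fin (q + 1), a.val + 1 = j := ⟨⟨j - 1, by omega⟩, by simp; omega⟩
      obtain ⟨d, hd⟩ : ∃ a : Fin (q + 1), a.val = j := ⟨⟨j, by omega⟩, rfl⟩
      have e := fun π => demStep_in q π i a b ha hb
      have e' := fun π => demStep_in q π j c d hc hd
      have n1 : c ≠ a := by rintro rfl; omega
      have n2 : c ≠ b := by rintro rfl; omega
      have n3 : d ≠ a := by rintro rfl; omega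
      have n4 : d ≠ b := by rintro rfl; omega
      have hsw : Equiv.swap a b * Equiv.swap c d = Equiv.swap c d * Equiv.swap a b := by
        ext x
        simp only [Equiv.Perm.mul_apply, Equiv.swap_apply_def]
        grind
      have k1 : Equiv.swap a b c = c := Equiv.swap_apply_of_ne_of_ne n1 n2
      have k2 : Equiv.swap a b d = d := Equiv.swap_apply_of_ne_of_ne n3 n4
      have k3 : Equiv.swap c d a = a := Equiv.swap_apply_of_ne_of_ne n1.symm n3.symm
      have k4 : Equiv.swap c d b = b := Equiv.swap_apply_of_ne_of_ne n2.symm n4.symm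
      simp only [e, e']
      by_cases u : π a < π b <;> by_cases v : π c < π d <;>
        simp [u, v, k1, k2, k3, k4, mul_assoc, hsw]
    · simp only [demStep_out q _ j h']
  · simp only [demStep_out q _ i h]

lemma demStep_braid (q : ℕ) (π : Equiv.Perm (Fin (q + 1))) (i : ℕ) :
    demStep q (demStep q (demStep q π i) (i + 1)) i =
      demStep q (demStep q (demStep q π (i + 1)) i) (i + 1) := by
  by_cases h : 1 ≤ i ∧ i ≤ q
  · by_cases h' : i + 1 ≤ q
    · obtain ⟨a, ha⟩ : ∃ a : Fin (q + 1), a.val + 1 = i := ⟨⟨i - 1, by omega⟩, by simp; omega⟩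
      obtain ⟨b, hb⟩ : ∃ a : Fin (q + 1), a.val = i := ⟨⟨i, by omega⟩, rfl⟩
      obtain ⟨c, hc⟩ : ∃ a : Fin (q + 1), a.val = i + 1 := ⟨⟨i + 1, by omega⟩, rfl⟩
      have e := fun π => demStep_in q π i a b ha hb
      have e' := fun π => demStep_in q π (i + 1) b c (by omega) hc
      have n1 : a ≠ b := by rintro rfl; omega
      have n2 : a ≠ c := by rintro rfl; omega
      have n3 : b ≠ c := by rintro rfl; omega
      have k1 : Equiv.swap a b c = c := Equiv.swap_apply_of_ne_of_ne n2.symm n3.symm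
      have k2 : Equiv.swap b c a = a := Equiv.swap_apply_of_ne_of_ne n1 n2
      have hbr : π * Equiv.swap a b * Equiv.swap b c * Equiv.swap a b =
          π * Equiv.swap b c * Equiv.swap a b * Equiv.swap b c := by
        ext x
        simp only [Equiv.Perm.mul_apply, Equiv.swap_apply_def]
        grind
      have m1 : π a ≠ π b := fun h => n1 (π.injective h)
      have m2 : π a ≠ π c := fun h => n2 (π.injective h)
      have m3 : π b ≠ π c := fun h => n3 (π.injective h)
      simp only [e, e']
      rcases lt_or_gt_of_ne m1 with h1 | h1 <;> rcases lt_or_gt_of_ne m2 with h2 | h2 <;>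
      rcases lt_or_gt_of_ne m3 with h3 | h3 <;>
      first
        | (exfalso; order)
        | simp [h1, h2, h3, not_lt.mpr h1.le, not_lt.mpr h2.le, not_lt.mpr h3.le, k1, k2, hbr]
    · have h'' : ¬ (1 ≤ i + 1 ∧ i + 1 ≤ q) := by omega
      simp only [demStep_out q _ (i + 1) h'', demStep_idem]
  · simp only [demStep_out q _ i h, demStep_idem]

/-- The monoid of operators on permutations (acting on the right). -/
abbrev OpM (q : ℕ) := (Function.End (Equiv.Perm (Fin (q + 1))))ᵐᵒᵖ

/-- The generator of the 0-Hecke monoid attached to a letter. -/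
def gen (q i : ℕ) : OpM q := MulOpposite.op (fun π => demStep q π i)

/-- The operator attached to a word. -/
def act (q : ℕ) (u : List ℕ) : OpM q := (u.map (gen q)).prod

lemma act_apply (q : ℕ) (u : List ℕ) (π : Equiv.Perm (Fin (q + 1))) :
    (MulOpposite.unop (act q u)) π = u.foldl (demStep q) π := by
  induction u generalizing π with
  | nil => rfl
  | cons a u ih =>
    rw [List.foldl_cons, ← ih]
    simp [act, gen]
    rfl

lemma heckeW_eq (q : ℕ) (u : List ℕ) : heckeW q u = (MulOpposite.unop (act q u)) 1 :=
  (act_apply q u 1).symm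

lemma act_append (q : ℕ) (u v : List ℕ) : act q (u ++ v) = act q u * act q v := by
  simp [act]

lemma act_cons (q : ℕ) (x : ℕ) (v : List ℕ) : act q (x :: v) = gen q x * act q v := by
  simp [act]

lemma act_nil (q : ℕ) : act q [] = 1 := rfl

lemma gen_idem (q i : ℕ) : gen q i * gen q i = gen q i := by
  apply MulOpposite.unop_injective
  funext π
  exact demStep_idem q π i

lemma gen_comm' (q i j : ℕ) (h : i + 2 ≤ j) : gen q i * gen q j = gen q j * gen q i := by
  apply MulOpposite.unop_injective
  funext π
  exact demStep_comm q π i j h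

lemma gen_braid (q i : ℕ) :
    gen q i * gen q (i + 1) * gen q i = gen q (i + 1) * gen q i * gen q (i + 1) := by
  apply MulOpposite.unop_injective
  funext π
  exact demStep_braid q π i

lemma gen_comm (q i j : ℕ) (h : i + 2 ≤ j ∨ j + 2 ≤ i) : Commute (gen q i) (gen q j) := by
  rcases h with h | h
  · exact gen_comm' q i j h
  · exact (gen_comm' q j i h).symm

lemma act_comm (q x : ℕ) (u : List ℕ) (h : ∀ c ∈ u, x + 2 ≤ c ∨ c + 2 ≤ x) :
    Commute (gen q x) (act q u) := by
  induction u with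
  | nil => exact Commute.one_right _
  | cons a u ih =>
    rw [act_cons]
    exact (gen_comm q x a (h a (by simp))).mul_right (ih fun c hc => h c (by simp [hc]))

lemma act_comm2 (q : ℕ) (u v : List ℕ) (h : ∀ c ∈ u, ∀ d ∈ v, c + 2 ≤ d ∨ d + 2 ≤ c) :
    Commute (act q u) (act q v) := by
  induction u with
  | nil => exact Commute.one_left _
  | cons a u ih =>
    rw [act_cons]
    exact (act_comm q a v (h a (by simp))).mul_left (ih fun c hc => h c (by simp [hc]))

/-! ### Local row insertion identities -/

lemma bump_a (q x y : ℕ) (C D : List ℕ) (hC : ∀ c ∈ C, c < x) (hxy : x < y)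
    (hD : ∀ d ∈ D, y < d) :
    act q (C ++ y :: D) * gen q x = gen q y * act q (C ++ x :: D) := by
  have h1 := act_comm q x D (fun d hd => by have := hD d hd; omega)
  have h2 := act_comm q y C (fun c hc => by have := hC c hc; omega)
  simp only [act_append, act_cons]
  rw [mul_assoc, mul_assoc, ← h1.eq, ← mul_assoc (act q C), ← h2.eq, mul_assoc]

lemma bump_b (q x y : ℕ) (A D : List ℕ) (hA : ∀ c ∈ A, c < x) (hxy : x < y)
    (hD : ∀ d ∈ D, y < d) :
    act q (A ++ x :: y :: D) * gen q x = gen q y * act q (A ++ x :: y :: D) := by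
  have h1 := act_comm q x D (fun d hd => by have := hD d hd; omega)
  have h2 := act_comm q y A (fun c hc => by have := hA c hc; omega)
  have h3 : gen q x * gen q y * gen q x = gen q y * gen q x * gen q y := by
    by_cases h : y = x + 1
    · subst h; exact gen_braid q x
    · have := (gen_comm q x y (by omega)).eq
      rw [this, mul_assoc, gen_idem, mul_assoc, this, ← mul_assoc, gen_idem]
  simp only [act_append, act_cons]
  calc _ = act q A * (gen q x * gen q y * (act q D * gen q x)) := by simp only [mul_assoc]
    _ = act q A * ((gen q x * gen q y * gen q x) * act q D) := by
        rw [← h1.eq]; simp only [mul_assoc]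
    _ = (act q A * gen q y) * (gen q x * gen q y * act q D) := by
        rw [h3]; simp only [mul_assoc]
    _ = _ := by rw [← h2.eq]; simp only [mul_assoc]

lemma absorb (q x : ℕ) (A B : List ℕ) (hA : ∀ c ∈ A, c + 2 ≤ x) :
    gen q x * act q (A ++ x :: B) = act q (A ++ x :: B) := by
  have h1 := act_comm q x A (fun c hc => by have := hA c hc; omega)
  simp only [act_append, act_cons]
  rw [← mul_assoc, h1.eq, mul_assoc, ← mul_assoc (gen q x), gen_idem]

lemma bump_c (q x y : ℕ) (A B C D : List ℕ) (hC : ∀ c ∈ C, c < x) (hxy : x < y)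
    (hA : ∀ c ∈ A, c + 2 ≤ x) :
    act q (C ++ y :: D) * gen q x * act q (A ++ x :: B) =
      gen q y * act q (C ++ y :: D) * act q (A ++ x :: B) := by
  have h2 := act_comm q y C (fun c hc => by have := hC c hc; omega)
  rw [mul_assoc, absorb q x A B hA]
  congr 1
  simp only [act_append, act_cons]
  rw [← mul_assoc (gen q y) (act q C), h2.eq, mul_assoc, ← mul_assoc (gen q y) (gen q y), gen_idem]

/-! ### Increasing tableaux and Hecke insertion, row by row -/

/-- Row `R` may be placed directly below row `Q` in an increasing tableau. -/
def Below (Q R : List ℕ) : Prop :=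
  R.length ≤ Q.length ∧ ∀ j, j < R.length → Q.getD j 0 < R.getD j 0

/-- A nonempty strictly increasing row with entries in `{1,…,q}`. -/
def GoodRow (q : ℕ) (R : List ℕ) : Prop :=
  R ≠ [] ∧ R.Pairwise (· < ·) ∧ ∀ e ∈ R, 1 ≤ e ∧ e ≤ q

/-- The rows of the list form an increasing tableau below the row `Q`. -/
def Tab (q : ℕ) : List ℕ → List (List ℕ) → Prop
  | _, [] => True
  | Q, R :: L => GoodRow q R ∧ Below Q R ∧ Tab q R L

/-- Increasing tableaux. -/
def FullTab (q : ℕ) : List (List ℕ) → Prop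
  | [] => True
  | R :: L => GoodRow q R ∧ Tab q R L

/-- The row reading word. -/
def rword : List (List ℕ) → List ℕ
  | [] => []
  | R :: L => rword L ++ R

/-- The row obtained after a bumping step. -/
def newRow (c : Prop) [Decidable c] (R : List ℕ) (p x : ℕ) : List ℕ :=
  if (p = 0 ∨ R.getD (p - 1) 0 < x) ∧ c then R.set p x else R

/-- Hecke insertion into the rows below the row `Q`. -/
def rins : List ℕ → List (List ℕ) → ℕ → List (List ℕ)
  | Q, [], x => if 0 < Q.length ∧ Q.getD 0 0 < x then [[x]] else []
  | Q, R :: L, x =>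
    if R.all (· ≤ x) then
      if x ∉ R ∧ R.length < Q.length ∧ Q.getD R.length 0 < x then (R ++ [x]) :: L else R :: L
    else
      let p := (R.takeWhile (· ≤ x)).length
      let R' := newRow (Q.getD p 0 < x) R p x
      R' :: rins R' L (R.getD p 0)

lemma getD_mid (P : List (List ℕ)) (Q : List ℕ) (L : List (List ℕ)) :
    (P ++ Q :: L).getD P.length [] = Q := by
  simp [List.getD_eq_getElem?_getD]

lemma getD_mid1 (P : List (List ℕ)) (Q : List ℕ) (L : List (List ℕ)) :
    (P ++ Q :: L).getD (P.length + 1) [] = L.headD [] := by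
  cases L <;> simp [List.getD_eq_getElem?_getD]

lemma setRow_mid (P : List (List ℕ)) (Q R R' : List ℕ) (L : List (List ℕ)) :
    setRow (P ++ Q :: R :: L) (P.length + 1) R' = P ++ Q :: R' :: L := by
  simp [setRow]

lemma heckeAux_eq (P : List (List ℕ)) (Q : List ℕ) (L : List (List ℕ)) (x : ℕ) :
    heckeAux (L.length + 1) x (P ++ Q :: L) (P.length + 1) = P ++ Q :: rins Q L x := by
  induction L generalizing P Q x with
  | nil =>
    simp [heckeAux, rins, setRow, List.getD_eq_getElem?_getD]
    split_ifs <;> simp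
  | cons R L ih =>
    rw [List.length_cons, heckeAux, rins]
    simp only [getD_mid1, List.headD_cons, Nat.add_sub_cancel, getD_mid, setRow_mid,
      Nat.add_eq_zero_iff, one_ne_zero, and_false, false_or]
    split_ifs with h1 h2 h3
    · rfl
    · rfl
    · have := ih (P ++ [Q]) (R.set (R.takeWhile (· ≤ x)).length x)
        (R.getD (R.takeWhile (· ≤ x)).length 0)
      simp only [List.append_assoc, List.length_append, List.length_cons, List.length_nil,
        List.cons_append, List.nil_append, zero_add] at this
      rw [this, newRow, if_pos h3]
    · have := ih (P ++ [Q]) R (R.getD (R.takeWhile (· ≤ x)).length 0)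
      simp only [List.append_assoc, List.length_append, List.length_cons, List.length_nil,
        List.cons_append, List.nil_append, zero_add] at this
      rw [this, newRow, if_neg h3]

lemma heckeInsert_nil (x : ℕ) : heckeInsert [] x = [[x]] := by
  simp [heckeInsert, heckeAux, setRow]

lemma heckeInsert_cons (R : List ℕ) (L : List (List ℕ)) (x : ℕ) :
    heckeInsert (R :: L) x =
      if R.all (· ≤ x) then (if x ∉ R then (R ++ [x]) :: L else R :: L)
      else
        newRow True R (R.takeWhile (· ≤ x)).length x ::
          rins (newRow True R (R.takeWhile (· ≤ x)).length x) L
            (R.getD (R.takeWhile (· ≤ x)).length 0) := by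
  have key := fun R y => heckeAux_eq [] R L y
  simp only [List.nil_append, List.length_nil, zero_add] at key
  rw [heckeInsert, List.length_cons, heckeAux]
  simp only [List.getD_cons_zero, true_or, and_true, setRow, List.length_cons, Nat.zero_lt_succ,
    if_true, List.set_cons_zero, newRow, zero_add]
  split_ifs <;> simp [key]

/-- Splitting a row at the bumped entry. -/
lemma row_split (R : List ℕ) (x : ℕ) (hR : R.Pairwise (· < ·)) (h : ¬ R.all (· ≤ x)) :
    ∃ C y D, R = C ++ y :: D ∧ (R.takeWhile (· ≤ x)) = C ∧ (∀ c ∈ C, c ≤ x) ∧ x < y ∧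
      (∀ d ∈ D, y < d) := by
  have hsp := List.takeWhile_append_dropWhile (p := fun a => decide (a ≤ x)) (l := R)
  have hne : R.dropWhile (fun a => decide (a ≤ x)) ≠ [] := by
    intro h0
    rw [List.dropWhile_eq_nil_iff] at h0
    apply h
    rw [List.all_eq_true]
    exact h0
  obtain ⟨y, D, hyD⟩ := List.exists_cons_of_ne_nil hne
  refine ⟨_, y, D, ?_, rfl, ?_, ?_, ?_⟩
  · rw [← hyD]; exact hsp.symm
  · intro c hc
    simpa using List.mem_takeWhile_imp hc
  · have := List.head_dropWhile_not (fun a => decide (a ≤ x)) hne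
    simp only [hyD, List.head_cons] at this
    simpa using this
  · rw [← hsp, hyD, List.pairwise_append, List.pairwise_cons] at hR
    exact hR.2.1.1

lemma getD_split (C D : List ℕ) (y : ℕ) : (C ++ y :: D).getD C.length 0 = y := by
  simp [List.getD_eq_getElem?_getD]

lemma set_split (C D : List ℕ) (y x : ℕ) : (C ++ y :: D).set C.length x = C ++ x :: D := by
  simp

/-- Algebraic content of a bumping step. -/
lemma bump_act (q x : ℕ) (c : Prop) [Decidable c] (C D Q : List ℕ) (y : ℕ)
    (hR : (C ++ y :: D).Pairwise (· < ·)) (hC : ∀ e ∈ C, e ≤ x) (hxy : x < y)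
    (hc : ¬ c → (∀ e ∈ C, e < x) → ∃ A B, Q = A ++ x :: B ∧ ∀ a ∈ A, a + 2 ≤ x) :
    gen q y * act q (newRow c (C ++ y :: D) C.length x) * act q Q =
      act q (C ++ y :: D) * gen q x * act q Q := by
  have hD : ∀ d ∈ D, y < d := by
    rw [List.pairwise_append, List.pairwise_cons] at hR
    exact hR.2.1.1
  have hCp : C.Pairwise (· < ·) := (List.pairwise_append.mp hR).1
  unfold newRow
  rw [set_split]
  rcases List.eq_nil_or_concat C with rfl | ⟨A, z, rfl⟩
  · by_cases h : c
    · simp only [List.length_nil, h, true_or, and_self, if_true]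
      rw [bump_a q x y [] D (by simp) hxy hD]
    · obtain ⟨A, B, rfl, hA⟩ := hc h (by simp)
      rw [if_neg (fun h' => h h'.2)]
      exact (bump_c q x y A B [] D (by simp) hxy hA).symm
  · simp only [List.concat_eq_append] at *
    have hz : (A ++ [z] ++ y :: D).getD ((A ++ [z]).length - 1) 0 = z := by
      simp [List.getD_eq_getElem?_getD]
    have hAz : ∀ a ∈ A, a < z := fun a ha =>
      (List.pairwise_append.mp hCp).2.2 a ha z (by simp)
    have hzx : z ≤ x := hC z (by simp)
    rw [hz]
    by_cases hlt : z < x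
    · have hCx : ∀ e ∈ A ++ [z], e < x := by
        intro e he
        rcases List.mem_append.mp he with he | he
        · exact (hAz e he).trans hlt
        · rw [List.mem_singleton] at he; omega
      by_cases h : c
      · rw [if_pos ⟨Or.inr hlt, h⟩, bump_a q x y _ D hCx hxy hD]
      · obtain ⟨A', B, rfl, hA⟩ := hc h hCx
        rw [if_neg (fun h' => h h'.2)]
        exact (bump_c q x y A' B _ D hCx hxy hA).symm
    · have : z = x := by omega
      subst this
      rw [if_neg (by
        rintro ⟨h1 | h1, -⟩
        · simp at h1
        · exact hlt h1)]
      have := bump_b q z y A D hAz hxy hD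
      simp only [List.append_assoc, List.cons_append, List.nil_append]
      rw [this]

lemma newRow_length (c : Prop) [Decidable c] (R : List ℕ) (p x : ℕ) :
    (newRow c R p x).length = R.length := by
  unfold newRow; split_ifs <;> simp

lemma newRow_getD_le (c : Prop) [Decidable c] (C D : List ℕ) (x y j : ℕ) (hxy : x < y) :
    (newRow c (C ++ y :: D) C.length x).getD j 0 ≤ (C ++ y :: D).getD j 0 := by
  unfold newRow
  rw [set_split]
  split_ifs
  · simp only [List.getD_eq_getElem?_getD]
    rcases lt_trichotomy j C.length with h | h | h
    · rw [List.getElem?_append_left h, List.getElem?_append_left h]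
    · subst h; simp [hxy.le]
    · rw [List.getElem?_append_right h.le, List.getElem?_append_right h.le]
      obtain ⟨k, hk⟩ : ∃ k, j - C.length = k + 1 := ⟨j - C.length - 1, by omega⟩
      rw [hk]; simp
  · exact le_rfl

lemma newRow_good (q : ℕ) (c : Prop) [Decidable c] (C D : List ℕ) (x y : ℕ)
    (hR : GoodRow q (C ++ y :: D)) (hxy : x < y) (hx : 1 ≤ x ∧ x ≤ q) :
    GoodRow q (newRow c (C ++ y :: D) C.length x) := by
  unfold newRow
  rw [set_split]
  split_ifs with h
  · obtain ⟨-, h2, h3⟩ := hR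
    refine ⟨by simp, ?_, ?_⟩
    · rw [List.pairwise_append, List.pairwise_cons] at h2 ⊢
      refine ⟨h2.1, ⟨fun d hd => hxy.trans (h2.2.1.1 d hd), h2.2.1.2⟩, ?_⟩
      intro a ha b hb
      rcases List.mem_cons.mp hb with rfl | hb
      · rcases List.eq_nil_or_concat C with rfl | ⟨A, z, rfl⟩
        · simp at ha
        · simp only [List.concat_eq_append] at *
          have hz : (A ++ [z] ++ y :: D).getD ((A ++ [z]).length - 1) 0 = z := by
            simp [List.getD_eq_getElem?_getD]
          rw [hz] at h
          have hzx : z < b := by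
            rcases h.1 with h | h
            · simp at h
            · exact h
          rcases List.mem_append.mp ha with he | he
          · exact ((List.pairwise_append.mp h2.1).2.2 a he z (by simp)).trans hzx
          · rw [List.mem_singleton] at he; omega
      · exact h2.2.2 a ha b (by simp [hb])
    · intro e he
      simp only [List.mem_append, List.mem_cons] at he h3
      rcases he with he | rfl | he
      · exact h3 e (by simp [he])
      · exact hx
      · exact h3 e (by simp [he])
  · exact hR

lemma newRow_below (Q C D : List ℕ) (x y : ℕ) (hB : Below Q (C ++ y :: D)) :
    Below Q (newRow (Q.getD C.length 0 < x) (C ++ y :: D) C.length x) := by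
  refine ⟨by rw [newRow_length]; exact hB.1, ?_⟩
  rw [newRow_length]
  intro j hj
  have := hB.2 j hj
  unfold newRow
  rw [set_split]
  split_ifs with h
  · rcases lt_trichotomy j C.length with h1 | h1 | h1
    · simp only [List.getD_eq_getElem?_getD] at *
      rw [List.getElem?_append_left h1] at *; exact this
    · subst h1; rw [getD_split]; exact h.2
    · simp only [List.getD_eq_getElem?_getD] at *
      rw [List.getElem?_append_right h1.le] at this ⊢
      obtain ⟨k, hk⟩ : ∃ k, j - C.length = k + 1 := ⟨j - C.length - 1, by omega⟩
      rw [hk] at this ⊢; simpa using this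
  · exact this

lemma Below.mono (R R' S : List ℕ) (hl : R.length ≤ R'.length)
    (h : ∀ j < R.length, R'.getD j 0 ≤ R.getD j 0) (hB : Below R S) : Below R' S :=
  ⟨hB.1.trans hl, fun j hj => (h j (by have := hB.1; omega)).trans_lt (hB.2 j hj)⟩

lemma Tab.mono (q : ℕ) (R R' : List ℕ) (L : List (List ℕ)) (hl : R.length ≤ R'.length)
    (h : ∀ j < R.length, R'.getD j 0 ≤ R.getD j 0) (hB : Tab q R L) : Tab q R' L := by
  cases L with
  | nil => trivial
  | cons S L => exact ⟨hB.1, Below.mono R R' S hl h hB.2.1, hB.2.2⟩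

/-- The value `x` was just bumped out of row `Q` (which sits above row `R`). -/
def Bumped (Q R : List ℕ) (x : ℕ) : Prop :=
  ∃ p, p < Q.length ∧ Q.getD p 0 ≤ x ∧ (p < R.length → x < R.getD p 0)

lemma getD_lt (Q : List ℕ) (hQ : Q.Pairwise (· < ·)) (i j : ℕ) (hij : i < j) (hj : j < Q.length) :
    Q.getD i 0 < Q.getD j 0 := by
  rw [List.getD_eq_getElem _ _ (hij.trans hj), List.getD_eq_getElem _ _ hj]
  exact List.pairwise_iff_getElem.mp hQ i j _ hj hij

/-- If the column condition fails then `x` sits in the row above, right at the column. -/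
lemma fail_split (Q C E : List ℕ) (x : ℕ) (hQ : Q.Pairwise (· < ·))
    (hB : Below Q (C ++ E))
    (hI : Bumped Q (C ++ E) x) (hC : ∀ e ∈ C, e < x)
    (hc : ¬ (C.length < Q.length ∧ Q.getD C.length 0 < x)) :
    ∃ A B, Q = A ++ x :: B ∧ ∀ a ∈ A, a + 2 ≤ x := by
  have hCget : ∀ j < C.length, (C ++ E).getD j 0 < x := by
    intro j hj
    rw [List.getD_eq_getElem?_getD, List.getElem?_append_left hj, List.getElem?_eq_getElem hj]
    exact hC _ (List.getElem_mem _)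
  obtain ⟨p, hp, hpx, hpR⟩ := hI
  have hle : C.length ≤ p := by
    by_contra hlt
    push Not at hlt
    have h1 := hpR (by rw [List.length_append]; omega)
    have h2 := hCget p hlt
    omega
  have hlen : C.length < Q.length := by omega
  have hge : x ≤ Q.getD C.length 0 := by
    by_contra h
    exact hc ⟨hlen, by omega⟩
  have heq : C.length = p := by
    by_contra hne
    have := getD_lt Q hQ C.length p (by omega) hp
    omega
  have hx : Q.getD C.length 0 = x := by rw [← heq] at hpx; omega
  rw [List.getD_eq_getElem _ _ hlen] at hx
  refine ⟨Q.take C.length, Q.drop (C.length + 1), ?_, ?_⟩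
  · conv_lhs => rw [← List.take_append_drop C.length Q]
    rw [List.drop_eq_getElem_cons hlen, hx]
  · intro a ha
    obtain ⟨j, hj, rfl⟩ := List.getElem_of_mem ha
    rw [List.length_take] at hj
    have hj' : j < C.length := by omega
    have h1 := hB.2 j (by rw [List.length_append]; omega)
    have h2 := hCget j hj'
    rw [List.getD_eq_getElem _ _ (by omega)] at h1
    rw [List.getElem_take]
    omega

lemma goodRow_append (q x : ℕ) (R : List ℕ) (hR : R.Pairwise (· < ·))
    (he : ∀ e ∈ R, 1 ≤ e ∧ e ≤ q) (hx : 1 ≤ x ∧ x ≤ q) (h : ∀ e ∈ R, e < x) :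
    GoodRow q (R ++ [x]) := by
  refine ⟨by simp, ?_, ?_⟩
  · rw [List.pairwise_append]
    exact ⟨hR, by simp, fun a ha b hb => by rw [List.mem_singleton] at hb; rw [hb]; exact h a ha⟩
  · intro e hm
    rcases List.mem_append.mp hm with hm | hm
    · exact he e hm
    · rw [List.mem_singleton] at hm; rw [hm]; exact hx

lemma append_getD_le (R : List ℕ) (x j : ℕ) (hj : j < R.length) :
    (R ++ [x]).getD j 0 ≤ R.getD j 0 := by
  simp [List.getD_eq_getElem?_getD, List.getElem?_append_left hj]

lemma act_last (q x : ℕ) (R : List ℕ) (hR : R.Pairwise (· < ·)) (h : ∀ e ∈ R, e ≤ x)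
    (hx : x ∈ R) : act q R * gen q x = act q R := by
  rcases List.eq_nil_or_concat R with rfl | ⟨A, z, rfl⟩
  · simp at hx
  · simp only [List.concat_eq_append] at *
    have hz := h z (by simp)
    have : z = x := by
      rcases List.mem_append.mp hx with hx | hx
      · have := (List.pairwise_append.mp hR).2.2 x hx z (by simp)
        omega
      · rw [List.mem_singleton] at hx; exact hx.symm
    subst this
    simp only [act_append, act_cons, act_nil, mul_one, mul_assoc, gen_idem]

lemma bumped_next (q x y : ℕ) (c : Prop) [Decidable c] (C D : List ℕ) (L : List (List ℕ))
    (hxy : x < y) (hT : Tab q (C ++ y :: D) L) :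
    Bumped (newRow c (C ++ y :: D) C.length x) (L.headD []) y := by
  refine ⟨C.length, by rw [newRow_length]; simp, ?_, ?_⟩
  · refine (newRow_getD_le c C D x y _ hxy).trans ?_
    rw [getD_split]
  · cases L with
    | nil => simp
    | cons S L =>
      intro h
      have := hT.2.1.2 C.length h
      rwa [getD_split] at this

lemma rins_spec (q : ℕ) (L : List (List ℕ)) (Q : List ℕ) (x : ℕ) (hQ : GoodRow q Q)
    (hT : Tab q Q L) (hx : 1 ≤ x ∧ x ≤ q) (hI : Bumped Q (L.headD []) x) :
    Tab q Q (rins Q L x) ∧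
      act q (rword (rins Q L x)) * act q Q = act q (rword L) * gen q x * act q Q := by
  induction L generalizing Q x with
  | nil =>
    rw [rins]
    split_ifs with h
    · refine ⟨⟨?_, ?_, trivial⟩, ?_⟩
      · exact goodRow_append q x [] (by simp) (by simp) hx (by simp)
      · refine ⟨by simp; omega, ?_⟩
        intro j hj
        have : j = 0 := by simpa using hj
        subst this
        simpa using h.2
      · simp [rword, act_cons, act_nil]
    · refine ⟨trivial, ?_⟩
      obtain ⟨A, B, hAB, hA⟩ := fail_split Q [] [] x hQ.2.1 ⟨by simp, by simp⟩ hI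
        (by simp) h
      rw [hAB, mul_assoc, absorb q x A B hA]
  | cons R L ih =>
    obtain ⟨hR, hB, hT⟩ := hT
    simp only [List.headD_cons] at hI
    rw [rins]
    split_ifs with h1 h2
    · have hlt : ∀ e ∈ R, e < x := by
        intro e he
        have : e ≤ x := by simpa using (List.all_eq_true.mp h1) e he
        exact lt_of_le_of_ne this (fun h => h2.1 (h ▸ he))
      refine ⟨⟨goodRow_append q x R hR.2.1 hR.2.2 hx hlt, ?_, ?_⟩, ?_⟩
      · refine ⟨by simp; omega, ?_⟩
        intro j hj
        rw [List.length_append, List.length_singleton] at hj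
        by_cases hj' : j < R.length
        · have := hB.2 j hj'
          simpa [List.getD_eq_getElem?_getD, List.getElem?_append_left hj'] using this
        · have : j = R.length := by omega
          subst this
          rw [getD_split]; exact h2.2.2
      · exact Tab.mono q R _ L (by simp) (fun j hj => append_getD_le R x j hj) hT
      · simp only [rword, act_append, act_cons, act_nil, mul_one, mul_assoc]
    · refine ⟨⟨hR, hB, hT⟩, ?_⟩
      have hle : ∀ e ∈ R, e ≤ x := fun e he => by simpa using (List.all_eq_true.mp h1) e he
      by_cases hm : x ∈ R
      · simp only [rword, act_append]
        rw [mul_assoc (act q (rword L)) (act q R) (gen q x), act_last q x R hR.2.1 hle hm]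
      · have hlt : ∀ e ∈ R, e < x := fun e he =>
          lt_of_le_of_ne (hle e he) (fun h => hm (h ▸ he))
        obtain ⟨A, B, hAB, hA⟩ := fail_split Q R [] x hQ.2.1 (by simpa using hB)
          (by simpa using hI) hlt (fun h => h2 ⟨hm, h⟩)
        rw [hAB, mul_assoc _ (gen q x), absorb q x A B hA]
    · obtain ⟨C, y, D, rfl, hC, hCx, hxy, hD⟩ := row_split R x hR.2.1 h1
      simp only [hC, getD_split]
      have hy : 1 ≤ y ∧ y ≤ q := hR.2.2 y (by simp)
      have hG := newRow_good q (Q.getD C.length 0 < x) C D x y hR hxy hx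
      have := ih (newRow (Q.getD C.length 0 < x) (C ++ y :: D) C.length x) y hG
        (Tab.mono q _ _ L (by rw [newRow_length])
          (fun j _ => newRow_getD_le _ C D x y j hxy) hT) hy
        (bumped_next q x y _ C D L hxy hT)
      refine ⟨⟨hG, newRow_below Q C D x y hB, this.1⟩, ?_⟩
      rw [rword, rword, act_append, this.2, act_append]
      have hb := bump_act q x (Q.getD C.length 0 < x) C D Q y hR.2.1 hCx hxy (by
        intro hc hCl
        exact fail_split Q C (y :: D) x hQ.2.1 hB hI hCl (fun h => hc h.2))
      simp only [mul_assoc] at hb ⊢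
      rw [hb]

lemma heckeInsert_spec (q : ℕ) (T : List (List ℕ)) (x : ℕ) (hT : FullTab q T)
    (hx : 1 ≤ x ∧ x ≤ q) :
    FullTab q (heckeInsert T x) ∧
      act q (rword (heckeInsert T x)) = act q (rword T) * gen q x := by
  cases T with
  | nil =>
    rw [heckeInsert_nil]
    refine ⟨⟨goodRow_append q x [] (by simp) (by simp) hx (by simp), trivial⟩, ?_⟩
    simp [rword, act_cons, act_nil]
  | cons R L =>
    obtain ⟨hR, hT⟩ := hT
    rw [heckeInsert_cons]
    split_ifs with h1 h2
    · refine ⟨⟨hR, hT⟩, ?_⟩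
      have hle : ∀ e ∈ R, e ≤ x := fun e he => by simpa using (List.all_eq_true.mp h1) e he
      simp only [rword, act_append]
      rw [mul_assoc, act_last q x R hR.2.1 hle h2]
    · have hlt : ∀ e ∈ R, e < x := by
        intro e he
        have : e ≤ x := by simpa using (List.all_eq_true.mp h1) e he
        exact lt_of_le_of_ne this (fun h => h2 (h ▸ he))
      refine ⟨⟨goodRow_append q x R hR.2.1 hR.2.2 hx hlt,
        Tab.mono q R _ L (by simp) (fun j hj => append_getD_le R x j hj) hT⟩, ?_⟩
      simp only [rword, act_append, act_cons, act_nil, mul_one, mul_assoc]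
    · obtain ⟨C, y, D, rfl, hC, hCx, hxy, hD⟩ := row_split R x hR.2.1 h1
      simp only [hC, getD_split]
      have hy : 1 ≤ y ∧ y ≤ q := hR.2.2 y (by simp)
      have hG := newRow_good q True C D x y hR hxy hx
      have := rins_spec q L (newRow True (C ++ y :: D) C.length x) y hG
        (Tab.mono q _ _ L (by rw [newRow_length])
          (fun j _ => newRow_getD_le _ C D x y j hxy) hT) hy
        (bumped_next q x y _ C D L hxy hT)
      refine ⟨⟨hG, this.1⟩, ?_⟩
      rw [rword, rword, act_append, this.2, act_append]
      have hb := bump_act q x True C D [] y hR.2.1 hCx hxy (fun h => absurd trivial h)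
      simp only [act_nil, mul_one] at hb
      rw [mul_assoc, mul_assoc, hb]

lemma heckeP_spec (q : ℕ) (w : List ℕ) (hw : ∀ x ∈ w, 1 ≤ x ∧ x ≤ q) :
    FullTab q (heckeP w) ∧ act q (rword (heckeP w)) = act q w := by
  induction w using List.reverseRecOn with
  | nil => exact ⟨trivial, rfl⟩
  | append_singleton w x ih =>
    obtain ⟨h1, h2⟩ := ih (fun y hy => hw y (by simp [hy]))
    have := heckeInsert_spec q (heckeP w) x h1 (hw x (by simp))
    have e : heckeP (w ++ [x]) = heckeInsert (heckeP w) x := by simp [heckeP]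
    rw [e]
    refine ⟨this.1, ?_⟩
    rw [this.2, h2, act_append, act_cons, act_nil, mul_one]

/-! ### Staircase shapes -/

/-- The staircase partition `(m, m-1, …, 1)`. -/
def stair : ℕ → List ℕ
  | 0 => []
  | m + 1 => (m + 1) :: stair m

lemma stair_eq (q : ℕ) : (List.range q).map (fun i => q - i) = stair q := by
  induction q with
  | zero => rfl
  | succ q ih =>
    rw [List.range_succ_eq_map, List.map_cons, List.map_map, stair, ← ih]
    simp only [Nat.sub_zero, List.cons.injEq, true_and]
    apply List.map_congr_left
    intro i _
    simp

lemma stair_sum (m : ℕ) : (stair m).sum = ∑ i ∈ Finset.range (m + 1), i := by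
  induction m with
  | zero => rfl
  | succ m ih => rw [Finset.sum_range_succ, ← ih, stair, List.sum_cons, add_comm]

lemma row_subset (q m : ℕ) (R : List ℕ) (hR : GoodRow q R) (h : ∀ e ∈ R, q + 1 ≤ e + (m + 1)) :
    R.toFinset ⊆ Finset.Icc (q - m) q ∧ R.toFinset.card = R.length := by
  refine ⟨?_, List.toFinset_card_of_nodup (hR.2.1.imp fun h => h.ne)⟩
  intro e he
  rw [List.mem_toFinset] at he
  have h1 := h e he
  have h2 := hR.2.2 e he
  rw [Finset.mem_Icc]
  omega

lemma row_len (q m : ℕ) (R : List ℕ) (hR : GoodRow q R) (h : ∀ e ∈ R, q + 1 ≤ e + (m + 1)) :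
    R.length ≤ m + 1 := by
  obtain ⟨h1, h2⟩ := row_subset q m R hR h
  have := Finset.card_le_card h1
  rw [Nat.card_Icc] at this
  omega

lemma row_full (q m : ℕ) (R : List ℕ) (hR : GoodRow q R) (h : ∀ e ∈ R, q + 1 ≤ e + (m + 1))
    (hl : R.length = m + 1) (x : ℕ) (hx : x ≤ q) (hxm : q ≤ x + m) : x ∈ R := by
  obtain ⟨h1, h2⟩ := row_subset q m R hR h
  have := Finset.eq_of_subset_of_card_le h1 (by rw [Nat.card_Icc]; omega)
  rw [← List.mem_toFinset, this, Finset.mem_Icc]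
  omega

lemma next_row (q m : ℕ) (R S : List ℕ) (h : ∀ e ∈ R, q + 1 ≤ e + (m + 1)) (hB : Below R S) :
    ∀ e ∈ S, q + 1 ≤ e + m := by
  intro e he
  obtain ⟨j, hj, rfl⟩ := List.getElem_of_mem he
  have h1 := hB.2 j hj
  have hj' : j < R.length := by have := hB.1; omega
  rw [List.getD_eq_getElem _ _ hj, List.getD_eq_getElem _ _ hj'] at h1
  have := h _ (List.getElem_mem hj')
  omega

lemma tab_bound (q m : ℕ) (R : List ℕ) (L : List (List ℕ)) (hR : GoodRow q R) (hT : Tab q R L)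
    (h : ∀ e ∈ R, q + 1 ≤ e + m) :
    (rword (R :: L)).length ≤ (stair m).sum ∧
      ((stair m).sum ≤ (rword (R :: L)).length → (R :: L).map List.length = stair m) := by
  induction m generalizing R L with
  | zero =>
    exfalso
    obtain ⟨e, he⟩ := List.exists_mem_of_ne_nil R hR.1
    have h1 := h e he
    have h2 := hR.2.2 e he
    omega
  | succ m ih =>
    have hl := row_len q m R hR h
    cases L with
    | nil =>
      simp only [rword, List.nil_append, stair, List.sum_cons, List.map_cons, List.map_nil]
      refine ⟨by omega, ?_⟩
      intro h'
      have h0 : (stair m).sum = 0 := by omega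
      have hm : m = 0 := by
        cases m with
        | zero => rfl
        | succ m => simp [stair] at h0
      subst hm
      have : R.length = 0 + 1 := by omega
      rw [this]; rfl
    | cons S L =>
      have := ih S L hT.1 hT.2.2 (next_row q m R S h hT.2.1)
      rw [rword, List.length_append, stair, List.sum_cons]
      refine ⟨by omega, ?_⟩
      intro h'
      rw [List.map_cons, this.2 (by omega)]
      congr 1
      omega

lemma stair_absorb (q m : ℕ) (R : List ℕ) (L : List (List ℕ)) (hR : GoodRow q R)
    (hT : Tab q R L) (h : ∀ e ∈ R, q + 1 ≤ e + m)
    (hs : (R :: L).map List.length = stair m) (x : ℕ) (hx : x ≤ q) (hxm : q + 1 ≤ x + m) :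
    act q (rword (R :: L)) * gen q x = act q (rword (R :: L)) := by
  induction m generalizing R L x with
  | zero => omega
  | succ m ih =>
    rw [List.map_cons, stair, List.cons.injEq] at hs
    obtain ⟨hlen, hs⟩ := hs
    have hxR := row_full q m R hR h hlen x hx (by omega)
    rw [rword, act_append, mul_assoc]
    by_cases hxq : x = q
    · rw [act_last q x R hR.2.1 (fun e he => by have := hR.2.2 e he; omega) hxR]
    · have hyR := row_full q m R hR h hlen (x + 1) (by omega) (by omega)
      obtain ⟨A, E, rfl⟩ := List.append_of_mem hxR
      have hp := hR.2.1
      rw [List.pairwise_append, List.pairwise_cons] at hp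
      obtain ⟨-, ⟨hxE, hE⟩, hAE⟩ := hp
      have hyE : x + 1 ∈ E := by
        rcases List.mem_append.mp hyR with h1 | h1
        · have := hAE _ h1 x (by simp)
          omega
        · rcases List.mem_cons.mp h1 with h1 | h1
          · omega
          · exact h1
      cases E with
      | nil => simp at hyE
      | cons y D =>
        have hxy := hxE y (by simp)
        rw [List.pairwise_cons] at hE
        have hy : y = x + 1 := by
          rcases List.mem_cons.mp hyE with h1 | h1
          · exact h1.symm
          · have := hE.1 _ h1
            omega
        subst hy
        rw [bump_b q x (x + 1) A D (fun c hc => hAE c hc x (by simp)) hxy hE.1, ← mul_assoc]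
        congr 1
        cases L with
        | nil =>
          exfalso
          cases m with
          | zero => omega
          | succ m => simp [stair] at hs
        | cons S L =>
          exact ih S L hT.1 hT.2.2 (next_row q m _ S h hT.2.1) hs (x + 1) (by omega) (by omega)

lemma lenPerm_foldl (q : ℕ) (u : List ℕ) (π : Equiv.Perm (Fin (q + 1))) :
    lenPerm q (u.foldl (demStep q) π) ≤ lenPerm q π + u.length := by
  induction u generalizing π with
  | nil => simp
  | cons a u ih =>
    have h1 := ih (demStep q π a)
    have h2 := demStep_len q π a
    rw [List.foldl_cons, List.length_cons]
    omega

lemma lenPerm_one (q : ℕ) : lenPerm q 1 = 0 := by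
  rw [lenPerm, Finset.card_eq_zero, Finset.filter_eq_empty_iff]
  rintro p - ⟨h1, h2⟩
  exact absurd h1 (not_lt.mpr h2.le)

lemma lenPerm_rev (q : ℕ) : lenPerm q Fin.revPerm = (stair q).sum := by
  rw [stair_sum, lenPerm, Finset.card_filter, Fintype.sum_prod_type_right]
  rw [Finset.sum_range]
  apply Finset.sum_congr rfl
  intro b _
  rw [← Finset.card_filter, ← Fin.card_Iio b]
  congr 1
  ext a
  simp

lemma eq_rev_of_desc (q : ℕ) (π : Equiv.Perm (Fin (q + 1)))
    (h : ∀ i, 1 ≤ i → i ≤ q → demStep q π i = π) : π = Fin.revPerm := by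
  have hanti : StrictAnti π := by
    rw [Fin.strictAnti_iff_succ_lt]
    intro i
    have h1 := h (i.val + 1) (by omega) (by omega)
    rw [demStep_in q π (i.val + 1) i.castSucc i.succ (by simp) (by simp)] at h1
    have hne : i.castSucc ≠ i.succ := by
      intro h
      have := congrArg Fin.val h
      simp at this
    have hne' : π i.castSucc ≠ π i.succ := fun h => hne (π.injective h)
    split_ifs at h1 with h2
    · exfalso
      have h3 := congrArg (fun f : Equiv.Perm (Fin (q + 1)) => f i.castSucc) h1
      simp only [Equiv.Perm.mul_apply, Equiv.swap_apply_left] at h3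
      exact hne' h3.symm
    · exact lt_of_le_of_ne (not_lt.mp h2) hne'.symm
  have hmono : StrictMono (fun i => Fin.rev (π i)) := fun a b hab =>
    Fin.rev_lt_rev.mpr (hanti hab)
  have hid : (fun i => Fin.rev (π i)) = id := by
    apply (StrictMono.range_inj hmono strictMono_id).mp
    rw [Set.range_id]
    exact ((Fin.rev_bijective.comp π.bijective).surjective).range_eq
  ext i : 1
  have := congrFun hid i
  simp only [id] at this
  rw [Fin.revPerm_apply, ← Fin.rev_eq_iff]
  exact this

/-- The Hecke shape of `w ∈ W_{n,q}` is the full staircase `(q, q−1, …, 1)`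
if and only if `W(w)` is the longest element `w₀` of `S_{q+1}`. -/
theorem heckeShape_staircase_iff (n q : ℕ) (hq : 1 ≤ q) (w : List ℕ)
    (hlen : w.length = n) (hent : ∀ x ∈ w, 1 ≤ x ∧ x ≤ q) :
    heckeShape w = (List.range q).map (fun i => q - i) ↔
      heckeW q w = Fin.revPerm := by
  obtain ⟨hF, hA⟩ := heckeP_spec q w hent
  rw [stair_eq, heckeShape]
  have hW : heckeW q w = heckeW q (rword (heckeP w)) := by
    rw [heckeW_eq, heckeW_eq, hA]
  generalize heckeP w = T at *
  have hq0 : stair q ≠ [] := by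
    cases q with
    | zero => omega
    | succ q => simp [stair]
  cases T with
  | nil =>
    constructor
    · intro h
      exact absurd h.symm hq0
    · intro h
      exfalso
      have h0 : heckeW q w = 1 := hW
      have h1 := lenPerm_rev q
      rw [← h, h0, lenPerm_one] at h1
      cases q with
      | zero => omega
      | succ q => rw [stair, List.sum_cons] at h1; omega
  | cons R L =>
    obtain ⟨hR, hT⟩ := hF
    have hge : ∀ e ∈ R, q + 1 ≤ e + q := fun e he => by
      have := hR.2.2 e he
      omega
    constructor
    · intro hs
      apply eq_rev_of_desc
      intro i hi hiq
      have h1 := stair_absorb q q R L hR hT hge hs i hiq (by omega)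
      rw [hA] at h1
      have h2 : heckeW q (w ++ [i]) = heckeW q w := by
        rw [heckeW_eq, heckeW_eq, act_append, act_cons, act_nil, mul_one, h1]
      simpa [heckeW] using h2
    · intro h
      apply (tab_bound q q R L hR hT hge).2
      rw [← lenPerm_rev, ← h, hW]
      have := lenPerm_foldl q (rword (R :: L)) 1
      rw [lenPerm_one, zero_add] at this
      exact this
end
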